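/- arXiv:1003.1649 — 4 statements merged into one kernel-verified Lean document; each statement's English description precedes it below -/
import Mathlib

section
/- Let n ≥ 1 be an integer and let A ⊆ ℝⁿ be a Borel set with μ(A) > 0. Then ∫_{ℝⁿ} d(x, A)² dμ(x) ≤ 2·log(1/μ(A)), where d(x, A) = inf{‖x − a‖ : a ∈ A} is the Euclidean distance from x to A; equivalently, μ(A) ≤ exp(−(1/2)·∫ d(x,A)² dμ(x)). -/
open MeasureTheory

/-- The standard Gaussian measure on `ℝⁿ`. -/
noncomputable def stdGaussian (n : ℕ) : Measure (EuclideanSpace ℝ (Fin n)) :=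
  volume.withDensity fun x =>
    ENNReal.ofReal ((2 * Real.pi) ^ (-(n : ℝ) / 2) * Real.exp (-‖x‖ ^ 2 / 2))

section

open Filter Topology Set
open ProbabilityTheory hiding stdGaussian

section Transport

variable {p q : ℝ → ℝ}

lemma hasDerivAt_integral_Iic (hp : Continuous p) (hpi : Integrable p) (x : ℝ) :
    HasDerivAt (fun x => ∫ t in Iic x, p t) (p x) x := by
  have hEq : (fun x => ∫ t in Iic x, p t) =
      fun x => (∫ t in Iic (0 : ℝ), p t) + ∫ t in (0 : ℝ)..x, p t := by
    funext y
    rw [← intervalIntegral.integral_Iic_sub_Iic hpi.integrableOn hpi.integrableOn]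
    ring
  rw [hEq]
  exact (intervalIntegral.integral_hasDerivAt_right (hp.intervalIntegrable _ _)
    (hp.stronglyMeasurableAtFilter _ _) hp.continuousAt).const_add _

lemma strictMono_integral_Iic (hp : Continuous p) (hpi : Integrable p) (hpos : ∀ x, 0 < p x) :
    StrictMono fun x => ∫ t in Iic x, p t :=
  strictMono_of_hasDerivAt_pos (fun x => hasDerivAt_integral_Iic hp hpi x) hpos

lemma exists_integral_Iic_eq (hp : Continuous p) (hpi : Integrable p)
    {c : ℝ} (hc0 : 0 < c) (hc1 : c < ∫ t, p t) : ∃ x, ∫ t in Iic x, p t = c := by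
  have hbot : Tendsto (fun x : ℝ => ∫ t in Iic x, p t) atBot (𝓝 0) :=
    tendsto_integral_Iic_zero tendsto_id
  have htop : Tendsto (fun x : ℝ => ∫ t in Iic x, p t) atTop (𝓝 (∫ t, p t)) :=
    (aecover_Iic tendsto_id).integral_tendsto_of_countably_generated hpi
  obtain ⟨a, ha⟩ := (hbot.eventually_lt_const hc0).exists
  obtain ⟨b, hb⟩ := (htop.eventually_const_lt hc1).exists
  exact mem_range_of_exists_le_of_exists_ge
    (continuous_iff_continuousAt.2 fun x => (hasDerivAt_integral_Iic hp hpi x).continuousAt)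
    ⟨a, ha.le⟩ ⟨b, hb.le⟩

lemma integral_Iic_mem_Ioo (hpi : Integrable p) (hpos : ∀ x, 0 < p x)
    (x : ℝ) : (∫ t in Iic x, p t) ∈ Ioo 0 (∫ t, p t) := by
  have hsupp : Function.support p = univ := eq_univ_of_forall fun x => (hpos x).ne'
  have hIic : 0 < ∫ t in Iic x, p t := by
    rw [setIntegral_pos_iff_support_of_nonneg_ae (ae_of_all _ fun x => (hpos x).le)
      hpi.integrableOn, hsupp]
    simp
  have hIoi : 0 < ∫ t in Ioi x, p t := by
    rw [setIntegral_pos_iff_support_of_nonneg_ae (ae_of_all _ fun x => (hpos x).le)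
      hpi.integrableOn, hsupp]
    simp
  have hadd := intervalIntegral.integral_Iic_add_Ioi (b := x) hpi.integrableOn hpi.integrableOn
  exact ⟨hIic, by linarith⟩

/-- The monotone rearrangement of one positive continuous density onto another of the same mass
solves the one-dimensional Monge-Ampère equation. -/
lemma exists_monotone_transport (hp : Continuous p) (hpi : Integrable p) (hppos : ∀ x, 0 < p x)
    (hq : Continuous q) (hqi : Integrable q) (hqpos : ∀ x, 0 < q x) (hpq : ∫ t, p t = ∫ t, q t) :
    ∃ T : ℝ → ℝ, (∀ x, HasDerivAt T (p x / q (T x)) x) ∧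
      (∀ x, ∫ t in Iic (T x), q t = ∫ t in Iic x, p t) ∧
      ∀ x, ∫ t in Ioi (T x), q t = ∫ t in Ioi x, p t := by
  have hpm := integral_Iic_mem_Ioo hpi hppos
  have hqm := integral_Iic_mem_Ioo hqi hqpos
  choose T hT using fun x => exists_integral_Iic_eq hq hqi (hpm x).1 (hpq ▸ (hpm x).2)
  have hpmono := strictMono_integral_Iic hp hpi hppos
  have hqmono := strictMono_integral_Iic hq hqi hqpos
  have hmono : Monotone T := fun x y hxy => by
    rw [← hqmono.le_iff_le]
    simpa only [hT] using hpmono.monotone hxy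
  have hsurj : Function.Surjective T := fun y => by
    obtain ⟨x, hx⟩ := exists_integral_Iic_eq hp hpi (hqm y).1 (hpq ▸ (hqm y).2)
    exact ⟨x, hqmono.injective ((hT x).trans hx)⟩
  have hcont : Continuous T := hmono.continuous_of_surjective hsurj
  refine ⟨T, fun x => ?_, hT, fun x => ?_⟩
  · have hstrict : HasStrictDerivAt (fun x => ∫ t in Iic x, q t) (q (T x)) (T x) :=
      hasStrictDerivAt_of_hasDerivAt_of_continuousAt
        (Eventually.of_forall fun y => hasDerivAt_integral_Iic hq hqi y) hq.continuousAt
    have hne := (hqpos (T x)).ne'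
    have hinv := (hstrict.to_localInverse hne).hasDerivAt
    have hleft := hcont.continuousAt.eventually (hstrict.eventually_left_inverse hne)
    rw [hT x] at hinv
    have hcomp := hinv.comp x (hasDerivAt_integral_Iic hp hpi x)
    rw [div_eq_inv_mul]
    refine hcomp.congr_of_eventuallyEq ?_
    filter_upwards [hleft] with y hy
    rw [hT y] at hy
    exact hy.symm
  · have h1 := intervalIntegral.integral_Iic_add_Ioi (b := x) hpi.integrableOn hpi.integrableOn
    have h2 := intervalIntegral.integral_Iic_add_Ioi (b := T x) hqi.integrableOn hqi.integrableOn
    linarith [hT x]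

end Transport

/-- The dual form of a transport-entropy inequality with cost `c`, on bounded Lipschitz functions:
`∫ exp (-g) ∂μ ≤ exp (-∫ h ∂μ)` whenever `h` lies below the infimal convolution of `g` and `c`. -/
def DualTransportInequality {X : Type*} [PseudoMetricSpace X] [MeasurableSpace X]
    (c : X → X → ℝ) (μ : Measure X) : Prop :=
  ∀ (g h : X → ℝ) (K : NNReal) (M : ℝ), LipschitzWith K g → (∀ x, 0 ≤ g x) → (∀ x, g x ≤ M) →
    Measurable h → (∀ x, 0 ≤ h x) → (∀ x y, h x ≤ g y + c x y) →
    ∫ x, Real.exp (-g x) ∂μ ≤ Real.exp (-∫ x, h x ∂μ)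

section RealLine

lemma gaussianPDFReal_zero_one (x : ℝ) :
    gaussianPDFReal 0 1 x = (√(2 * Real.pi))⁻¹ * Real.exp (-x ^ 2 / 2) := by
  simp [gaussianPDFReal]

lemma gaussianPDFReal_zero_one_anti {x y : ℝ} (h : x ^ 2 ≤ y ^ 2) :
    gaussianPDFReal 0 1 y ≤ gaussianPDFReal 0 1 x := by
  simp only [gaussianPDFReal_zero_one]
  gcongr

lemma continuous_gaussianPDFReal_zero_one : Continuous (gaussianPDFReal 0 1) := by
  rw [show gaussianPDFReal 0 1 = _ from funext gaussianPDFReal_zero_one]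
  fun_prop

lemma hasDerivAt_gaussianPDFReal_zero_one (x : ℝ) :
    HasDerivAt (gaussianPDFReal 0 1) (-x * gaussianPDFReal 0 1 x) x := by
  rw [show gaussianPDFReal 0 1 = _ from funext gaussianPDFReal_zero_one]
  have h : HasDerivAt (fun x : ℝ => -x ^ 2 / 2) (-x) x := by
    refine ((hasDerivAt_pow 2 x).fun_neg.div_const 2).congr_deriv ?_
    norm_num
    ring
  refine (h.exp.const_mul (√(2 * Real.pi))⁻¹).congr_deriv ?_
  ring

lemma integrable_sq_mul_gaussianPDFReal_zero_one :
    Integrable fun x : ℝ => x ^ 2 * gaussianPDFReal 0 1 x := by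
  have h := (integrable_rpow_mul_exp_neg_mul_sq (b := 1 / 2) (by norm_num) (s := 2)
    (by norm_num)).const_mul (√(2 * Real.pi))⁻¹
  refine h.congr (ae_of_all _ fun x => ?_)
  simp only [gaussianPDFReal_zero_one, Real.rpow_two]
  rw [show -(1 / 2) * x ^ 2 = -x ^ 2 / 2 by ring]
  ring

lemma gaussianPDFReal_le_setIntegral {S : Set ℝ} {a b : ℝ}
    (hsub : Ioc a (a + 1) ⊆ S) (hab : ∀ x ∈ Ioc a (a + 1), x ^ 2 ≤ b ^ 2) :
    gaussianPDFReal 0 1 b ≤ ∫ x in S, gaussianPDFReal 0 1 x := by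
  have hint := integrable_gaussianPDFReal 0 1
  calc gaussianPDFReal 0 1 b = ∫ _ in Ioc a (a + 1), gaussianPDFReal 0 1 b := by simp
    _ ≤ ∫ x in Ioc a (a + 1), gaussianPDFReal 0 1 x :=
      setIntegral_mono_on (by simp) hint.integrableOn measurableSet_Ioc
        fun x hx => gaussianPDFReal_zero_one_anti (hab x hx)
    _ ≤ ∫ x in S, gaussianPDFReal 0 1 x :=
      setIntegral_mono_set hint.integrableOn
        (ae_of_all _ fun x => gaussianPDFReal_nonneg 0 1 x) (LE.le.eventuallyLE hsub)

lemma sq_mul_setIntegral_le {q : ℝ → ℝ} (hqi : Integrable q) (hq0 : ∀ x, 0 ≤ q x)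
    (hq2 : Integrable fun x => x ^ 2 * q x) {S : Set ℝ} (hS : MeasurableSet S) {a : ℝ}
    (ha : ∀ x ∈ S, a ^ 2 ≤ x ^ 2) :
    a ^ 2 * ∫ x in S, q x ≤ ∫ x, x ^ 2 * q x := by
  calc a ^ 2 * ∫ x in S, q x = ∫ x in S, a ^ 2 * q x := (integral_const_mul _ _).symm
    _ ≤ ∫ x in S, x ^ 2 * q x :=
      setIntegral_mono_on (hqi.const_mul _).integrableOn hq2.integrableOn hS
        fun x hx => mul_le_mul_of_nonneg_right (ha x hx) (hq0 x)
    _ ≤ ∫ x, x ^ 2 * q x :=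
      setIntegral_le_integral hq2 (ae_of_all _ fun x => mul_nonneg (sq_nonneg x) (hq0 x))

lemma tendsto_gaussianPDFReal_div_sqrt_shift :
    Tendsto (fun R : ℝ => gaussianPDFReal 0 1 R / √(gaussianPDFReal 0 1 (R + 1))) atTop (𝓝 0) := by
  have hquad : Tendsto (fun R : ℝ => R * ((1 / 4) * R - 1 / 2)) atTop atTop :=
    tendsto_id.atTop_mul_atTop₀
      (tendsto_atTop_add_const_right _ _ (tendsto_id.const_mul_atTop (by norm_num)))
  have hexp := (Real.tendsto_exp_neg_atTop_nhds_zero.comp hquad).const_mul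
    (√((√(2 * Real.pi))⁻¹) * Real.exp (1 / 4))
  rw [mul_zero] at hexp
  refine hexp.congr fun R => ?_
  have hc : 0 < (√(2 * Real.pi))⁻¹ := by positivity
  simp only [gaussianPDFReal_zero_one, Function.comp]
  rw [Real.sqrt_mul hc.le, ← Real.exp_half, eq_div_iff (by positivity)]
  calc _ = (√((√(2 * Real.pi))⁻¹) * √((√(2 * Real.pi))⁻¹)) *
        (Real.exp (1 / 4) * Real.exp (-(R * (1 / 4 * R - 1 / 2))) *
          Real.exp (-(R + 1) ^ 2 / 2 / 2)) := by ring
    _ = _ := by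
      rw [Real.mul_self_sqrt hc.le, ← Real.exp_add, ← Real.exp_add]
      ring_nf

lemma mul_gaussianPDFReal_le {a B R : ℝ} (h : a ^ 2 * gaussianPDFReal 0 1 (R + 1) ≤ B) :
    a * gaussianPDFReal 0 1 R ≤
      √B * (gaussianPDFReal 0 1 R / √(gaussianPDFReal 0 1 (R + 1))) := by
  have hpos := gaussianPDFReal_pos 0 1 (R + 1) one_ne_zero
  have h1 : a * √(gaussianPDFReal 0 1 (R + 1)) ≤ √B := by
    apply Real.le_sqrt_of_sq_le
    rwa [mul_pow, Real.sq_sqrt hpos.le]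
  have h2 := (le_div_iff₀ (Real.sqrt_pos.2 hpos)).2 h1
  calc a * gaussianPDFReal 0 1 R
      ≤ √B / √(gaussianPDFReal 0 1 (R + 1)) * gaussianPDFReal 0 1 R :=
        mul_le_mul_of_nonneg_right h2 (gaussianPDFReal_nonneg 0 1 R)
    _ = _ := by ring

theorem dualTransportInequality_gaussianReal :
    DualTransportInequality (fun x y : ℝ => (x - y) ^ 2 / 2) (gaussianReal 0 1) := by
  intro g h K M hg hg0 hgM hh hh0 hgh
  set φ := gaussianPDFReal 0 1 with hφ
  have hφc : Continuous φ := continuous_gaussianPDFReal_zero_one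
  have hφi : Integrable φ := integrable_gaussianPDFReal 0 1
  have hφpos : ∀ x, 0 < φ x := fun x => gaussianPDFReal_pos 0 1 x one_ne_zero
  have hφ1 : ∫ x, φ x = 1 := integral_gaussianPDFReal_eq_one 0 one_ne_zero
  simp only [integral_gaussianReal_eq_integral_smul (one_ne_zero : (1 : NNReal) ≠ 0), smul_eq_mul]
  simp only [← hφ]
  have hgc := hg.continuous
  have hwle : ∀ x, φ x * Real.exp (-g x) ≤ φ x := fun x =>
    mul_le_of_le_one_right (hφpos x).le (Real.exp_le_one_iff.2 (neg_nonpos.2 (hg0 x)))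
  have hwpos : ∀ x, 0 < φ x * Real.exp (-g x) := fun x => mul_pos (hφpos x) (Real.exp_pos _)
  have hwc : Continuous fun x => φ x * Real.exp (-g x) := by fun_prop
  have hwi : Integrable fun x => φ x * Real.exp (-g x) :=
    hφi.mono' hwc.aestronglyMeasurable
      (ae_of_all _ fun x => by rw [Real.norm_of_nonneg (hwpos x).le]; exact hwle x)
  set Z := ∫ x, φ x * Real.exp (-g x) with hZ
  have hZpos : 0 < Z := by
    refine (integral_pos_iff_support_of_nonneg (fun x => (hwpos x).le) hwi).2 ?_
    rw [show Function.support _ = univ from eq_univ_of_forall fun x => (hwpos x).ne']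
    simp
  set q : ℝ → ℝ := fun x => φ x * Real.exp (-g x) / Z with hq
  have hqc : Continuous q := hwc.div_const Z
  have hqi : Integrable q := hwi.div_const Z
  have hqpos : ∀ x, 0 < q x := fun x => div_pos (hwpos x) hZpos
  have hq1 : ∫ x, φ x = ∫ x, q x := by
    rw [hφ1, hq, integral_div, ← hZ, div_self hZpos.ne']
  have hq2 : Integrable fun x => x ^ 2 * q x := by
    refine (integrable_sq_mul_gaussianPDFReal_zero_one.div_const Z).mono'
      (by fun_prop) (ae_of_all _ fun x => ?_)
    rw [Real.norm_of_nonneg (mul_nonneg (sq_nonneg x) (hqpos x).le), mul_div_assoc]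
    exact mul_le_mul_of_nonneg_left (div_le_div_of_nonneg_right (hwle x) hZpos.le) (sq_nonneg x)
  obtain ⟨T, hTd, hTIic, hTIoi⟩ := exists_monotone_transport hφc hφi hφpos hqc hqi hqpos hq1
  have hlog : ∀ x, Real.log (φ x / q (T x)) =
      -x ^ 2 / 2 + (T x) ^ 2 / 2 + g (T x) + Real.log Z := fun x => by
    have hc : 0 < (√(2 * Real.pi))⁻¹ := by positivity
    rw [Real.log_div (hφpos x).ne' (hqpos _).ne', hq,
      Real.log_div (hwpos _).ne' hZpos.ne', Real.log_mul (hφpos _).ne' (Real.exp_ne_zero _),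
      Real.log_exp, hφ, gaussianPDFReal_zero_one, gaussianPDFReal_zero_one,
      Real.log_mul hc.ne' (Real.exp_ne_zero _), Real.log_mul hc.ne' (Real.exp_ne_zero _),
      Real.log_exp, Real.log_exp]
    ring
  have hψ : ∀ x, HasDerivAt (fun x => (T x - x) * φ x)
      ((φ x / q (T x) - 1) * φ x + (T x - x) * (-x * φ x)) x := fun x =>
    ((hTd x).sub (hasDerivAt_id x)).mul (hasDerivAt_gaussianPDFReal_zero_one x)
  have hpt : ∀ x, φ x * h x + φ x * Real.log Z ≤
      (φ x / q (T x) - 1) * φ x + (T x - x) * (-x * φ x) := fun x => by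
    have h1 := Real.log_le_sub_one_of_pos (div_pos (hφpos x) (hqpos (T x)))
    have h2 := hgh x (T x)
    rw [hlog] at h1
    have h3 : h x + Real.log Z ≤ (φ x / q (T x) - 1) + (T x - x) * (-x) := by
      nlinarith
    nlinarith [mul_le_mul_of_nonneg_left h3 (hφpos x).le]
  have hhM : ∀ x, h x ≤ M := fun x => by simpa using (hgh x x).trans (by simpa using hgM x)
  have hhi : Integrable fun x => φ x * h x := by
    refine (hφi.mul_const M).mono' (by fun_prop) (ae_of_all _ fun x => ?_)
    rw [Real.norm_of_nonneg (mul_nonneg (hφpos x).le (hh0 x))]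
    exact mul_le_mul_of_nonneg_left (hhM x) (hφpos x).le
  have hsum : Integrable fun x => φ x * h x + φ x * Real.log Z := hhi.add (hφi.mul_const _)
  have hlim := intervalIntegral_tendsto_integral hsum tendsto_neg_atTop_atBot tendsto_id
  set B := ∫ x, x ^ 2 * q x
  have hbound : ∀ R : ℝ, 0 ≤ R → ∫ x in (-R)..R, (φ x * h x + φ x * Real.log Z) ≤
      2 * √B * (φ R / √(φ (R + 1))) := fun R hR => by
    have h1 := intervalIntegral.integral_le_sub_of_hasDeriv_right_of_le (by linarith : -R ≤ R)
      (continuous_iff_continuousAt.2 fun x => (hψ x).continuousAt).continuousOn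
      (fun x _ => (hψ x).hasDerivWithinAt) hsum.integrableOn (fun x _ => hpt x)
    have hnonneg : 0 ≤ √B * (φ R / √(φ (R + 1))) :=
      mul_nonneg (Real.sqrt_nonneg _) (div_nonneg (hφpos R).le (Real.sqrt_nonneg _))
    have hright : T R * φ R ≤ √B * (φ R / √(φ (R + 1))) := by
      rcases le_total (T R) 0 with hT | hT
      · exact (mul_nonpos_of_nonpos_of_nonneg hT (hφpos R).le).trans hnonneg
      · refine mul_gaussianPDFReal_le (le_trans ?_ (sq_mul_setIntegral_le hqi
          (fun x => (hqpos x).le) hq2 (S := Ioi (T R)) measurableSet_Ioi (a := T R)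
          fun x hx => pow_le_pow_left₀ hT (le_of_lt hx) 2))
        rw [hTIoi]
        refine mul_le_mul_of_nonneg_left (gaussianPDFReal_le_setIntegral
          (a := R) (fun x hx => hx.1) fun x hx => ?_) (sq_nonneg _)
        nlinarith [hx.1, hx.2]
    have hleft : -T (-R) * φ R ≤ √B * (φ R / √(φ (R + 1))) := by
      rcases le_total 0 (T (-R)) with hT | hT
      · exact (mul_nonpos_of_nonpos_of_nonneg (neg_nonpos.2 hT) (hφpos R).le).trans hnonneg
      · refine mul_gaussianPDFReal_le (le_trans ?_ (sq_mul_setIntegral_le hqi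
          (fun x => (hqpos x).le) hq2 (S := Iic (T (-R))) measurableSet_Iic (a := -T (-R))
          fun x hx => ?_))
        · rw [hTIic]
          refine mul_le_mul_of_nonneg_left (gaussianPDFReal_le_setIntegral
            (a := -R - 1) (fun x hx => ?_) fun x hx => ?_) (sq_nonneg _)
          · have := hx.2
            simp only [mem_Iic]
            linarith
          · nlinarith [hx.1, hx.2]
        · have : x ≤ T (-R) := hx
          nlinarith
    have hφneg : φ (-R) = φ R := by simp [hφ, gaussianPDFReal_zero_one]
    simp only [hφneg] at h1
    nlinarith [mul_nonneg hR (hφpos R).le]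
  have hlim0 := tendsto_gaussianPDFReal_div_sqrt_shift.const_mul (2 * √B)
  have hle := le_of_tendsto_of_tendsto hlim hlim0
    ((eventually_ge_atTop 0).mono fun R hR => hbound R hR)
  rw [integral_add hhi (hφi.mul_const _), integral_mul_const, hφ1] at hle
  rw [← Real.log_le_iff_le_exp hZpos]
  linarith

end RealLine

section Tensorization

lemma integrable_of_nonneg_of_le {X : Type*} [MeasurableSpace X] {μ : Measure X} [IsFiniteMeasure μ]
    {f : X → ℝ} {M : ℝ} (hf : Measurable f) (h0 : ∀ x, 0 ≤ f x) (hM : ∀ x, f x ≤ M) : Integrable f μ :=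
  Integrable.of_bound hf.aestronglyMeasurable M
    (ae_of_all _ fun x => by rw [Real.norm_of_nonneg (h0 x)]; exact hM x)

variable {X Y : Type*} [PseudoMetricSpace X] [MeasurableSpace X]
  [PseudoMetricSpace Y] [MeasurableSpace Y] [BorelSpace Y]

lemma dualTransportInequality_of_subsingleton [Subsingleton X] {c : X → X → ℝ}
    (hc : ∀ x, c x x = 0) (μ : Measure X) [IsProbabilityMeasure μ] :
    DualTransportInequality c μ := by
  intro g h K M _ _ _ _ _ hgh
  obtain ⟨x₀⟩ : Nonempty X := nonempty_of_isProbabilityMeasure μ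
  rw [show (fun x => Real.exp (-g x)) = fun _ => Real.exp (-g x₀) from
      funext fun x => by rw [Subsingleton.elim x x₀],
    show h = fun _ => h x₀ from funext fun x => by rw [Subsingleton.elim x x₀]]
  simpa [hc] using hgh x₀ x₀

/-- A dual transport inequality is inherited by images under Lipschitz maps that do not
increase the cost. -/
lemma DualTransportInequality.of_measurePreserving {c : X → X → ℝ} {c' : Y → Y → ℝ}
    {μ : Measure X} {ν : Measure Y} (hμ : DualTransportInequality c μ) {e : X → Y} {L : NNReal}
    (he : MeasurePreserving e μ ν) (heL : LipschitzWith L e)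
    (hcc' : ∀ x y, c' (e x) (e y) ≤ c x y) : DualTransportInequality c' ν := by
  intro g h K M hg hg0 hgM hh hh0 hgh
  have key := hμ (g ∘ e) (h ∘ e) (K * L) M (hg.comp heL) (fun x => hg0 _) (fun x => hgM _)
    (hh.comp he.measurable) (fun x => hh0 _)
    (fun x y => (hgh _ _).trans (add_le_add_right (hcc' x y) _))
  have hgm : Measurable fun y => Real.exp (-g y) := hg.continuous.measurable.neg.exp
  rw [← he.map_eq, integral_map he.aemeasurable hgm.aestronglyMeasurable,
    integral_map he.aemeasurable hh.aestronglyMeasurable]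
  exact key

lemma DualTransportInequality.prod [BorelSpace X] [SecondCountableTopology X]
    [SecondCountableTopology Y] {c : X → X → ℝ} {c' : Y → Y → ℝ} {μ : Measure X} {ν : Measure Y}
    [IsProbabilityMeasure μ] [IsProbabilityMeasure ν]
    (hμ : DualTransportInequality c μ) (hν : DualTransportInequality c' ν)
    (hcd : ∀ x, c x x = 0) (hc'0 : ∀ x y, 0 ≤ c' x y)
    (hc'd : ∀ x, c' x x = 0) (hc'c : ∀ y, Continuous fun x => c' x y) :
    DualTransportInequality (fun x y : X × Y => c x.1 y.1 + c' x.2 y.2) (μ.prod ν) := by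
  intro g h K M hg hg0 hgM hh hh0 hgh
  have hne : Nonempty Y := nonempty_of_isProbabilityMeasure ν
  -- infimal convolution of `g` and `c'` in the second variable
  set k : X → Y → ℝ := fun a y => ⨅ z, g (a, z) + c' y z with hk
  have hbdd : ∀ a y, BddBelow (range fun z => g (a, z) + c' y z) := fun a y =>
    ⟨0, by rintro _ ⟨z, rfl⟩; exact add_nonneg (hg0 _) (hc'0 _ _)⟩
  have hk_le : ∀ a y z, k a y ≤ g (a, z) + c' y z := fun a y z => ciInf_le (hbdd a y) z
  have hk0 : ∀ a y, 0 ≤ k a y := fun a y =>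
    le_ciInf fun z => add_nonneg (hg0 _) (hc'0 _ _)
  have hkM : ∀ a y, k a y ≤ M := fun a y => by
    simpa [hc'd] using (hk_le a y y).trans (by simpa [hc'd] using hgM (a, y))
  have hkm : ∀ a, Measurable (k a) := fun a =>
    (upperSemicontinuous_ciInf (hbdd a) fun z =>
      (continuous_const.add (hc'c z)).upperSemicontinuous).measurable
  have hki : ∀ a, Integrable (k a) ν := fun a =>
    integrable_of_nonneg_of_le (hkm a) (hk0 a) (hkM a)
  have hk_lip : ∀ a b y, k a y ≤ k b y + K * dist a b := fun a b y => by
    rw [← sub_le_iff_le_add]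
    refine le_ciInf fun z => ?_
    have h1 := hk_le a y z
    have h2 := (abs_le.1 (hg.dist_le_mul (a, z) (b, z))).2
    simp only [Prod.dist_eq, dist_self] at h2
    rw [max_eq_left dist_nonneg] at h2
    linarith
  set G : X → ℝ := fun a => ∫ y, k a y ∂ν with hG
  have hGlip : LipschitzWith K G := LipschitzWith.of_le_add_mul K fun a b => by
    calc G a ≤ ∫ y, (k b y + K * dist a b) ∂ν :=
          integral_mono (hki a) ((hki b).add (integrable_const _)) (hk_lip a b)
      _ = G b + K * dist a b := by
          rw [integral_add (hki b) (integrable_const _)]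
          simp [hG]
  have hG0 : ∀ a, 0 ≤ G a := fun a => integral_nonneg (hk0 a)
  have hGM : ∀ a, G a ≤ M := fun a => by
    simpa using integral_mono (hki a) (integrable_const M) (hkM a)
  have hhM : ∀ x, h x ≤ M := fun x =>
    (hgh x x).trans (by simpa [hcd, hc'd] using hgM x)
  have hhi : Integrable h (μ.prod ν) := integrable_of_nonneg_of_le hh hh0 hhM
  have hhi' : ∀ x, Integrable (fun y => h (x, y)) ν := fun x =>
    integrable_of_nonneg_of_le (hh.comp measurable_prodMk_left) (fun _ => hh0 _) fun _ => hhM _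
  have hgm : Measurable fun x => Real.exp (-g x) := hg.continuous.measurable.neg.exp
  have hgi : Integrable (fun x => Real.exp (-g x)) (μ.prod ν) :=
    integrable_of_nonneg_of_le (M := 1) hgm (fun x => (Real.exp_pos _).le) fun x => by
      simpa using hg0 x
  have hGi : Integrable (fun a => Real.exp (-G a)) μ :=
    integrable_of_nonneg_of_le (M := 1) hGlip.continuous.measurable.neg.exp
      (fun x => (Real.exp_pos _).le) fun x => by simpa using hG0 x
  have hfiber : ∀ a, ∫ y, Real.exp (-g (a, y)) ∂ν ≤ Real.exp (-G a) := fun a =>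
    hν (fun y => g (a, y)) (k a) K M
      (LipschitzWith.of_dist_le_mul fun y z => by
        simpa [Prod.dist_eq] using hg.dist_le_mul (a, y) (a, z))
      (fun _ => hg0 _) (fun _ => hgM _) (hkm a) (hk0 a) (fun y z => hk_le a y z)
  have hbase := hμ G (fun x => ∫ y, h (x, y) ∂ν) K M hGlip hG0 hGM
    hh.stronglyMeasurable.integral_prod_right'.measurable
    (fun x => integral_nonneg fun y => hh0 _) (fun x a => by
      calc ∫ y, h (x, y) ∂ν ≤ ∫ y, (k a y + c x a) ∂ν := by
            refine integral_mono (hhi' x) ((hki a).add (integrable_const _)) fun y => ?_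
            simp only
            rw [← sub_le_iff_le_add]
            refine le_ciInf fun z => ?_
            linarith [hgh (x, y) (a, z)]
        _ = G a + c x a := by
            rw [integral_add (hki a) (integrable_const _)]
            simp [hG])
  rw [integral_prod _ hgi, integral_prod _ hhi]
  exact (integral_mono hgi.integral_prod_left hGi hfiber).trans hbase

end Tensorization

section EuclideanSpace

theorem dualTransportInequality_pi_gaussianReal (n : ℕ) :
    DualTransportInequality (fun x y : Fin n → ℝ => ∑ i, (x i - y i) ^ 2 / 2)
      (Measure.pi fun _ => gaussianReal 0 1) := by
  induction n with
  | zero => exact dualTransportInequality_of_subsingleton (by simp) _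
  | succ n ih =>
    refine (dualTransportInequality_gaussianReal.prod ih (by simp) (fun x y => by positivity)
      (by simp) (fun y => by fun_prop)).of_measurePreserving (L := 1)
      (measurePreserving_piFinSuccAbove (fun _ : Fin (n + 1) => gaussianReal 0 1) 0).symm
      (LipschitzWith.of_dist_le_mul fun x y => ?_) fun x y => ?_
    · rw [NNReal.coe_one, one_mul, dist_pi_le_iff dist_nonneg]
      intro i
      refine Fin.cases ?_ (fun j => ?_) i
      · have h : dist x.1 y.1 ≤ dist x y := le_max_left _ _
        simpa [MeasurableEquiv.piFinSuccAbove_symm_apply, Fin.insertNthEquiv] using h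
      · have h : dist (x.2 j) (y.2 j) ≤ dist x y :=
          (dist_le_pi_dist x.2 y.2 j).trans (le_max_right _ _)
        simpa [MeasurableEquiv.piFinSuccAbove_symm_apply, Fin.insertNthEquiv] using h
    · simp [MeasurableEquiv.piFinSuccAbove_symm_apply, Fin.insertNthEquiv, Fin.sum_univ_succ]

lemma pi_gaussianReal_eq_withDensity (n : ℕ) :
    Measure.pi (fun _ : Fin n => gaussianReal 0 1) =
      (volume : Measure (Fin n → ℝ)).withDensity
        fun x => ENNReal.ofReal (∏ i, gaussianPDFReal 0 1 (x i)) := by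
  refine Measure.pi_eq fun s hs => ?_
  have hint : Integrable (fun x : Fin n → ℝ => ∏ i, gaussianPDFReal 0 1 (x i)) :=
    Integrable.fintype_prod fun _ => integrable_gaussianPDFReal 0 1
  rw [withDensity_apply _ (MeasurableSet.univ_pi hs),
    ← ofReal_integral_eq_lintegral_ofReal hint.integrableOn
      (ae_of_all _ fun x => Finset.prod_nonneg fun i _ => gaussianPDFReal_nonneg 0 1 _),
    volume_pi, Measure.restrict_pi_pi, integral_fintype_prod_eq_prod,
    ENNReal.ofReal_prod_of_nonneg fun i _ =>
      integral_nonneg fun x => gaussianPDFReal_nonneg 0 1 x]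
  simp_rw [gaussianReal_apply_eq_integral 0 one_ne_zero]

lemma measurePreserving_toLp_stdGaussian (n : ℕ) :
    MeasurePreserving (WithLp.toLp 2) (Measure.pi fun _ : Fin n => gaussianReal 0 1)
      (stdGaussian n) := by
  have hvol := PiLp.volume_preserving_toLp (Fin n)
  refine ⟨hvol.measurable, ?_⟩
  ext s hs
  rw [Measure.map_apply hvol.measurable hs, pi_gaussianReal_eq_withDensity,
    withDensity_apply _ (hvol.measurable hs), stdGaussian, withDensity_apply _ hs,
    ← hvol.setLIntegral_comp_preimage_emb (MeasurableEquiv.toLp 2 _).measurableEmbedding]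
  refine lintegral_congr fun x => ?_
  congr 1
  simp only [gaussianPDFReal_zero_one, Finset.prod_mul_distrib, Finset.prod_const,
    Finset.card_univ, Fintype.card_fin, ← Real.exp_sum]
  congr 1
  · rw [Real.sqrt_eq_rpow, ← Real.rpow_neg (by positivity), ← Real.rpow_natCast,
      ← Real.rpow_mul (by positivity)]
    congr 1
    ring
  · rw [EuclideanSpace.real_norm_sq_eq, ← Finset.sum_div, Finset.sum_neg_distrib]

theorem dualTransportInequality_stdGaussian (n : ℕ) :
    DualTransportInequality (fun x y : EuclideanSpace ℝ (Fin n) => dist x y ^ 2 / 2)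
      (stdGaussian n) :=
  (dualTransportInequality_pi_gaussianReal n).of_measurePreserving
    (measurePreserving_toLp_stdGaussian n) (PiLp.lipschitzWith_toLp 2 _) fun x y => by
      rw [EuclideanSpace.dist_eq, Real.sq_sqrt (by positivity), Finset.sum_div]
      simp [Real.dist_eq, sq_abs]

end EuclideanSpace

section DistanceToSet

variable {X : Type*} [PseudoMetricSpace X]

lemma half_sq_infDist_le (A : Set X) {k : ℝ} {x : X} (hx : Metric.infDist x A ≤ k) (y : X) :
    Metric.infDist x A ^ 2 / 2 ≤ min (k ^ 2) (k * Metric.infDist y A) + dist x y ^ 2 / 2 := by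
  have hd := Metric.infDist_nonneg (x := x) (s := A)
  have he := Metric.infDist_nonneg (x := y) (s := A)
  have htri := Metric.infDist_le_infDist_add_dist (s := A) (x := x) (y := y)
  have hxy := dist_nonneg (x := x) (y := y)
  rcases min_cases (k ^ 2) (k * Metric.infDist y A) with ⟨h, -⟩ | ⟨h, -⟩ <;> rw [h]
  · nlinarith [sq_nonneg (dist x y)]
  · rcases le_total (Metric.infDist x A) (Metric.infDist y A) with hle | hle
    · nlinarith [sq_nonneg (dist x y), mul_le_mul hx hle hd (hd.trans hx)]
    · nlinarith [mul_le_mul_of_nonneg_right hx he,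
        pow_le_pow_left₀ (sub_nonneg.2 hle) (sub_le_iff_le_add'.2 htri) 2]

variable [MeasurableSpace X] [BorelSpace X]

lemma DualTransportInequality.integral_indicator_infDist_le {μ : Measure X}
    [IsProbabilityMeasure μ] (hμ : DualTransportInequality (fun x y : X => dist x y ^ 2 / 2) μ)
    {A : Set X} (hA : MeasurableSet A) (hpos : 0 < μ.real A) (k : NNReal) :
    ∫ x, {x | Metric.infDist x A ≤ k}.indicator (fun x => Metric.infDist x A ^ 2 / 2) x ∂μ ≤
      Real.log (1 / μ.real A) := by
  have hdist : Measurable fun x => Metric.infDist x A :=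
    (Metric.continuous_infDist_pt A).measurable
  set g : X → ℝ := fun y => min ((k : ℝ) ^ 2) (k * Metric.infDist y A)
  have hg0 : ∀ y, 0 ≤ g y := fun y =>
    le_min (by positivity) (mul_nonneg k.2 Metric.infDist_nonneg)
  have hglip : LipschitzWith k g := by
    refine LipschitzWith.const_min (LipschitzWith.of_le_add_mul k fun x y => ?_) _
    rw [← mul_add]
    exact mul_le_mul_of_nonneg_left Metric.infDist_le_infDist_add_dist k.2
  have key := hμ g ({x | Metric.infDist x A ≤ k}.indicator fun x => Metric.infDist x A ^ 2 / 2)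
    k ((k : ℝ) ^ 2) hglip hg0 (fun y => min_le_left _ _)
    (((hdist.pow_const 2).div_const 2).indicator (measurableSet_le hdist measurable_const))
    (fun x => Set.indicator_nonneg (fun x _ => by positivity) x)
    (fun x y => Set.indicator_apply_le' (fun hx => half_sq_infDist_le A hx y)
      fun _ => add_nonneg (hg0 y) (by positivity))
  have hmass : μ.real A ≤ ∫ x, Real.exp (-g x) ∂μ := by
    rw [← integral_indicator_one hA]
    refine integral_mono ((integrable_const (1 : ℝ)).indicator hA)
      (integrable_of_nonneg_of_le (M := 1) hglip.continuous.measurable.neg.exp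
        (fun x => (Real.exp_pos _).le) fun x => by simpa using hg0 x)
      fun x => Set.indicator_apply_le' (fun hx => ?_) fun _ => (Real.exp_pos _).le
    simp [g, Metric.infDist_zero_of_mem hx]
  have hlog := (Real.log_le_iff_le_exp hpos).2 (hmass.trans key)
  rw [one_div, Real.log_inv]
  linarith

theorem DualTransportInequality.lintegral_infDist_sq_le {μ : Measure X} [IsProbabilityMeasure μ]
    (hμ : DualTransportInequality (fun x y : X => dist x y ^ 2 / 2) μ)
    {A : Set X} (hA : MeasurableSet A) (hpos : 0 < μ.real A) :
    ∫⁻ x, ENNReal.ofReal (Metric.infDist x A ^ 2) ∂μ ≤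
      ENNReal.ofReal (2 * Real.log (1 / μ.real A)) := by
  have hdist : Measurable fun x => Metric.infDist x A :=
    (Metric.continuous_infDist_pt A).measurable
  set h : ℕ → X → ℝ := fun k =>
    {x | Metric.infDist x A ≤ (k : NNReal)}.indicator fun x => Metric.infDist x A ^ 2 / 2
  have hm : ∀ k, Measurable (h k) := fun k =>
    ((hdist.pow_const 2).div_const 2).indicator (measurableSet_le hdist measurable_const)
  have h0 : ∀ k x, 0 ≤ h k x := fun k x => Set.indicator_nonneg (fun x _ => by positivity) x
  have hmono : Monotone h := fun i j hij =>
    Set.indicator_le_indicator_of_subset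
      (fun y (hy : Metric.infDist y A ≤ (i : NNReal)) => hy.trans (by exact_mod_cast hij))
      fun y => by positivity
  have hint : ∀ k, Integrable (h k) μ := fun k =>
    integrable_of_nonneg_of_le (M := (k : ℝ) ^ 2 / 2) (hm k) (h0 k) fun x =>
      Set.indicator_apply_le' (fun hx => div_le_div_of_nonneg_right
        (pow_le_pow_left₀ Metric.infDist_nonneg (by simpa using hx) 2) zero_le_two)
        fun _ => by positivity
  have hlim : Tendsto (fun k => ∫⁻ x, ENNReal.ofReal (2 * h k x) ∂μ) atTop
      (𝓝 (∫⁻ x, ENNReal.ofReal (Metric.infDist x A ^ 2) ∂μ)) := by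
    refine lintegral_tendsto_of_tendsto_of_monotone
      (fun k => ((hm k).const_mul 2).ennreal_ofReal.aemeasurable)
      (ae_of_all _ fun x i j hij => ENNReal.ofReal_le_ofReal
        (mul_le_mul_of_nonneg_left (hmono hij x) zero_le_two))
      (ae_of_all _ fun x => tendsto_const_nhds.congr' ?_)
    filter_upwards [eventually_ge_atTop ⌈Metric.infDist x A⌉₊] with k hk
    have hx : x ∈ {x | Metric.infDist x A ≤ (k : NNReal)} := by
      simpa using Nat.ceil_le.1 hk
    rw [show h k x = Metric.infDist x A ^ 2 / 2 from Set.indicator_of_mem hx _,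
      mul_div_cancel₀ _ two_ne_zero]
  refine le_of_tendsto' hlim fun k => ?_
  rw [← ofReal_integral_eq_lintegral_ofReal ((hint k).const_mul 2)
    (ae_of_all _ fun x => mul_nonneg zero_le_two (h0 k x)), integral_const_mul]
  exact ENNReal.ofReal_le_ofReal (mul_le_mul_of_nonneg_left
    (hμ.integral_indicator_infDist_le hA hpos k) zero_le_two)

end DistanceToSet

end

/-- For any Borel set `A` of positive Gaussian measure, the second moment of
the distance to `A` is bounded by `2 log (1/μ(A))`. -/
theorem gaussian_gauge_second_moment (n : ℕ) (hn : 1 ≤ n)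
    (A : Set (EuclideanSpace ℝ (Fin n))) (hA : MeasurableSet A)
    (hpos : 0 < stdGaussian n A) :
    ∫⁻ x, ENNReal.ofReal (Metric.infDist x A ^ 2) ∂stdGaussian n
      ≤ ENNReal.ofReal (2 * Real.log (1 / (stdGaussian n A).toReal)) := by
  have hmp := measurePreserving_toLp_stdGaussian n
  have : IsProbabilityMeasure (stdGaussian n) :=
    hmp.map_eq ▸ Measure.isProbabilityMeasure_map hmp.aemeasurable
  exact (dualTransportInequality_stdGaussian n).lintegral_infDist_sq_le hA
    (ENNReal.toReal_pos hpos.ne' (measure_ne_top _ _))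
end

section
/- Let n ≥ 1 be an integer, let A, B ⊆ ℝⁿ be Borel sets, and let ε > 0 be such that ‖a − b‖ ≥ ε for all a ∈ A and b ∈ B. Then μ(A)·μ(B) ≤ exp(−ε²/4). -/
open MeasureTheory

/-- The one-dimensional Brunn–Minkowski inequality for compact sets. -/
theorem volume_add_volume_le_of_isCompact {K L S : Set ℝ} (hK : IsCompact K) (hL : IsCompact L)
    (hK' : K.Nonempty) (hL' : L.Nonempty) (h : ∀ a ∈ K, ∀ b ∈ L, a + b ∈ S) :
    volume K + volume L ≤ volume S := by
  obtain ⟨l, hl, hlmin⟩ := hL.exists_isLeast hL'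
  obtain ⟨k, hk, hkmax⟩ := hK.exists_isGreatest hK'
  have hdisj : AEDisjoint volume ((fun x => x - l) ⁻¹' K) ((fun x => x - k) ⁻¹' L) := by
    refine measure_mono_null (t := {k + l}) ?_ (by simp)
    rintro x ⟨hx, hx'⟩
    have h₁ : x - l ≤ k := hkmax hx
    have h₂ : l ≤ x - k := hlmin hx'
    simp only [Set.mem_singleton_iff]
    linarith
  calc volume K + volume L
      = volume ((fun x => x - l) ⁻¹' K) + volume ((fun x => x - k) ⁻¹' L) := by
        simp only [sub_eq_add_neg, measure_preimage_add_right]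
    _ = volume ((fun x => x - l) ⁻¹' K ∪ (fun x => x - k) ⁻¹' L) := by
        refine (measure_union₀ (MeasurableSet.nullMeasurableSet ?_) hdisj).symm
        exact measurable_id.sub_const k hL.measurableSet
    _ ≤ volume S := by
        refine measure_mono (Set.union_subset (fun x hx => ?_) fun x hx => ?_)
        · simpa using h _ hx l hl
        · simpa using h k hk _ hx

/-- The one-dimensional Brunn–Minkowski inequality, for midpoints. -/
theorem volume_add_volume_le_two_mul {A B S : Set ℝ} (hA : MeasurableSet A) (hB : MeasurableSet B)
    (hA' : A.Nonempty) (hB' : B.Nonempty) (h : ∀ a ∈ A, ∀ b ∈ B, 2⁻¹ * (a + b) ∈ S) :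
    volume A + volume B ≤ 2 * volume S := by
  have hS : volume ((fun x => 2⁻¹ * x) ⁻¹' S) = 2 * volume S := by
    rw [Real.volume_preimage_mul_left (by norm_num)]
    simp
  obtain ⟨a, ha⟩ := hA'
  obtain ⟨b, hb⟩ := hB'
  rw [← hS]
  rw [hA.measure_eq_iSup_isCompact, hB.measure_eq_iSup_isCompact]
  simp only [iSup_and']
  refine ENNReal.biSup_add_biSup_le' ⟨∅, by simp⟩ ⟨∅, by simp⟩ ?_
  rintro K ⟨hKA, hK⟩ L ⟨hLB, hL⟩
  refine (add_le_add (measure_mono (Set.subset_insert a K))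
    (measure_mono (Set.subset_insert b L))).trans ?_
  exact volume_add_volume_le_of_isCompact (hK.insert a) (hL.insert b) (K.insert_nonempty a)
    (L.insert_nonempty b)
    fun x hx y hy => h x (Set.insert_subset ha hKA hx) y (Set.insert_subset hb hLB hy)

/-- Prékopa–Leindler for real functions with supremum one. -/
theorem lintegral_add_lintegral_le_of_sup_eq_one {f g h : ℝ → ℝ} (hf : Measurable f)
    (hg : Measurable g) (hh : Measurable h) (hf₀ : 0 ≤ f) (hg₀ : 0 ≤ g) (hh₀ : 0 ≤ h)
    (hf₁ : IsLUB (Set.range f) 1) (hg₁ : IsLUB (Set.range g) 1)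
    (hfgh : ∀ x y, f x * g y ≤ h (2⁻¹ * (x + y)) ^ 2) :
    (∫⁻ x, ENNReal.ofReal (f x)) + ∫⁻ x, ENNReal.ofReal (g x) ≤
      2 * ∫⁻ x, ENNReal.ofReal (h x) := by
  rw [lintegral_eq_lintegral_meas_lt _ (.of_forall hf₀) hf.aemeasurable,
    lintegral_eq_lintegral_meas_lt _ (.of_forall hg₀) hg.aemeasurable,
    lintegral_eq_lintegral_meas_lt _ (.of_forall hh₀) hh.aemeasurable,
    ← lintegral_const_mul' _ _ (by simp), ← lintegral_add_left]
  · refine setLIntegral_mono' measurableSet_Ioi fun t ht => ?_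
    have ht : 0 < t := ht
    rcases lt_or_ge t 1 with ht₁ | ht₁
    · obtain ⟨_, ⟨x, rfl⟩, hx, -⟩ := hf₁.exists_between ht₁
      obtain ⟨_, ⟨y, rfl⟩, hy, -⟩ := hg₁.exists_between ht₁
      refine volume_add_volume_le_two_mul (measurableSet_lt measurable_const hf)
        (measurableSet_lt measurable_const hg) ⟨x, hx⟩ ⟨y, hy⟩ fun a ha b hb => ?_
      refine lt_of_pow_lt_pow_left₀ 2 (hh₀ _) (lt_of_lt_of_le ?_ (hfgh a b))
      rw [sq]
      exact mul_lt_mul'' ha hb ht.le ht.le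
    · have hf' : {x | t < f x} = ∅ :=
        Set.eq_empty_of_forall_notMem fun x hx => (hx.trans_le (hf₁.1 ⟨x, rfl⟩)).not_ge ht₁
      have hg' : {x | t < g x} = ∅ :=
        Set.eq_empty_of_forall_notMem fun x hx => (hx.trans_le (hg₁.1 ⟨x, rfl⟩)).not_ge ht₁
      simp [hf', hg']
  · exact Antitone.measurable fun s t hst => measure_mono fun x hx => lt_of_le_of_lt hst hx

theorem ENNReal.four_mul_le_add_sq (x y : ENNReal) : 4 * (x * y) ≤ (x + y) ^ 2 := by
  rcases eq_or_ne x ⊤ with rfl | hx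
  · simp
  rcases eq_or_ne y ⊤ with rfl | hy
  · simp
  lift x to NNReal using hx
  lift y to NNReal using hy
  norm_cast
  rw [← mul_assoc]
  exact _root_.four_mul_le_sq_add x y

/-- Prékopa–Leindler on the line, in additive form, for functions with supremum one. -/
theorem lintegral_add_lintegral_le_of_iSup_eq_one {f g h : ℝ → ENNReal} (hf : Measurable f)
    (hg : Measurable g) (hh : Measurable h) (hf₁ : ⨆ x, f x = 1) (hg₁ : ⨆ x, g x = 1)
    (hfgh : ∀ x y, f x * g y ≤ h (2⁻¹ * (x + y)) ^ 2) :
    (∫⁻ x, f x) + ∫⁻ x, g x ≤ 2 * ∫⁻ x, h x := by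
  have key : ∀ {u : ℝ → ENNReal}, ⨆ x, u x = 1 →
      (∀ x, u x ≤ 1) ∧ IsLUB (Set.range fun x => (u x).toReal) 1 := by
    intro u hu
    have hu₁ : ∀ x, u x ≤ 1 := fun x => hu ▸ le_iSup u x
    refine ⟨hu₁, ?_, fun c hc => ?_⟩
    · rintro _ ⟨x, rfl⟩
      exact ENNReal.toReal_le_of_le_ofReal zero_le_one (by simpa using hu₁ x)
    · rw [← ENNReal.one_le_ofReal, ← hu]
      refine iSup_le fun x => ?_
      rw [ENNReal.le_ofReal_iff_toReal_le (ne_top_of_le_ne_top ENNReal.one_ne_top (hu₁ x))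
        (ENNReal.toReal_nonneg.trans (hc ⟨x, rfl⟩))]
      exact hc ⟨x, rfl⟩
  obtain ⟨hf_le, hf_lub⟩ := key hf₁
  obtain ⟨hg_le, hg_lub⟩ := key hg₁
  have hmin : ∀ x, min 1 (h x) ≠ ⊤ := fun x => ne_top_of_le_ne_top ENNReal.one_ne_top
    (min_le_left _ _)
  have hreal := lintegral_add_lintegral_le_of_sup_eq_one (h := fun x => (min 1 (h x)).toReal)
    hf.ennreal_toReal hg.ennreal_toReal (measurable_const.min hh).ennreal_toReal
    (fun _ => ENNReal.toReal_nonneg) (fun _ => ENNReal.toReal_nonneg)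
    (fun _ => ENNReal.toReal_nonneg) hf_lub hg_lub fun x y => by
      rw [← ENNReal.toReal_mul, ← ENNReal.toReal_pow]
      refine ENNReal.toReal_mono (ENNReal.pow_ne_top (hmin _)) ?_
      rcases le_total 1 (h (2⁻¹ * (x + y))) with h₁ | h₁
      · simpa [h₁] using mul_le_one' (hf_le x) (hg_le y)
      · simpa [h₁] using hfgh x y
  simp only [ENNReal.ofReal_toReal (hmin _),
    ENNReal.ofReal_toReal (ne_top_of_le_ne_top ENNReal.one_ne_top (hf_le _)),
    ENNReal.ofReal_toReal (ne_top_of_le_ne_top ENNReal.one_ne_top (hg_le _))] at hreal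
  refine hreal.trans ?_
  gcongr
  exact min_le_right _ _

theorem prekopa_leindler_real_of_bounded {f g h : ℝ → ENNReal} (hf : Measurable f)
    (hg : Measurable g) (hh : Measurable h) (hf_top : ⨆ x, f x ≠ ⊤) (hg_top : ⨆ x, g x ≠ ⊤)
    (hfgh : ∀ x y, f x * g y ≤ h (2⁻¹ * (x + y)) ^ 2) :
    (∫⁻ x, f x) * ∫⁻ x, g x ≤ (∫⁻ x, h x) ^ 2 := by
  set a := ⨆ x, f x with ha
  set b := ⨆ x, g x with hb
  rcases eq_or_ne a 0 with ha₀ | ha₀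
  · have : ∀ x, f x = 0 := fun x => le_antisymm ((le_iSup f x).trans_eq ha₀) bot_le
    simp [this]
  rcases eq_or_ne b 0 with hb₀ | hb₀
  · have : ∀ x, g x = 0 := fun x => le_antisymm ((le_iSup g x).trans_eq hb₀) bot_le
    simp [this]
  set s := (a * b)⁻¹ ^ (2⁻¹ : ℝ) with hs
  have hss : s ^ 2 = a⁻¹ * b⁻¹ := by
    rw [hs, ← ENNReal.rpow_natCast, ← ENNReal.rpow_mul, ENNReal.mul_inv (.inl ha₀) (.inl hf_top)]
    norm_num
  have hadd := lintegral_add_lintegral_le_of_iSup_eq_one (f := fun x => a⁻¹ * f x)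
    (g := fun x => b⁻¹ * g x) (h := fun x => s * h x) (hf.const_mul _) (hg.const_mul _)
    (hh.const_mul _) (by rw [← ENNReal.mul_iSup, ← ha, ENNReal.inv_mul_cancel ha₀ hf_top])
    (by rw [← ENNReal.mul_iSup, ← hb, ENNReal.inv_mul_cancel hb₀ hg_top]) fun x y => by
      rw [mul_pow, hss, mul_mul_mul_comm]
      gcongr
      exact hfgh x y
  rw [lintegral_const_mul _ hf, lintegral_const_mul _ hg, lintegral_const_mul _ hh] at hadd
  have hmul := (ENNReal.four_mul_le_add_sq _ _).trans (pow_le_pow_left' hadd 2)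
  rw [mul_pow, mul_pow, hss, mul_mul_mul_comm a⁻¹] at hmul
  have h4 : (2 : ENNReal) ^ 2 = 4 := by norm_num
  rw [h4, ENNReal.mul_le_mul_iff_right (by norm_num) (by norm_num)] at hmul
  refine (ENNReal.mul_le_mul_iff_right ?_ ?_).1 hmul
  · exact mul_ne_zero (ENNReal.inv_ne_zero.2 hf_top) (ENNReal.inv_ne_zero.2 hg_top)
  · exact ENNReal.mul_ne_top (ENNReal.inv_ne_top.2 ha₀) (ENNReal.inv_ne_top.2 hb₀)

theorem lintegral_eq_iSup_min {α : Type*} [MeasurableSpace α] {μ : Measure α}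
    {f : α → ENNReal} (hf : Measurable f) :
    ∫⁻ x, f x ∂μ = ⨆ k : ℕ, ∫⁻ x, min (f x) k ∂μ := by
  rw [← lintegral_iSup (fun k => hf.min measurable_const)
    fun k l hkl x => min_le_min le_rfl (by exact_mod_cast hkl)]
  refine lintegral_congr fun x => ?_
  rw [← inf_iSup_eq, ENNReal.iSup_natCast, inf_top_eq]

/-- The Prékopa–Leindler inequality on the line, for midpoints. -/
theorem prekopa_leindler_real {f g h : ℝ → ENNReal} (hf : Measurable f)
    (hg : Measurable g) (hh : Measurable h)
    (hfgh : ∀ x y, f x * g y ≤ h (2⁻¹ * (x + y)) ^ 2) :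
    (∫⁻ x, f x) * ∫⁻ x, g x ≤ (∫⁻ x, h x) ^ 2 := by
  rw [lintegral_eq_iSup_min hf, lintegral_eq_iSup_min hg]
  simp_rw [ENNReal.iSup_mul, ENNReal.mul_iSup]
  refine iSup₂_le fun k l => ?_
  refine prekopa_leindler_real_of_bounded (hf.min measurable_const) (hg.min measurable_const) hh
    (ne_top_of_le_ne_top (ENNReal.natCast_ne_top k) (iSup_le fun x => min_le_right _ _))
    (ne_top_of_le_ne_top (ENNReal.natCast_ne_top l) (iSup_le fun x => min_le_right _ _))
    fun x y => ?_
  exact (mul_le_mul' (min_le_left _ _) (min_le_left _ _)).trans (hfgh x y)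

theorem lintegral_fin_succ {n : ℕ} {f : (Fin (n + 1) → ℝ) → ENNReal} (hf : Measurable f) :
    ∫⁻ x, f x = ∫⁻ t : ℝ, ∫⁻ x : Fin n → ℝ, f (Fin.cons t x) := by
  have he := (volume_preserving_piFinSuccAbove (fun _ : Fin (n + 1) => ℝ) 0).symm _
  rw [← he.lintegral_comp hf, Measure.volume_eq_prod, lintegral_prod]
  · simp [MeasurableEquiv.piFinSuccAbove, Fin.insertNthEquiv]
  · exact (hf.comp he.measurable).aemeasurable

theorem measurable_finCons {n : ℕ} :
    Measurable fun p : ℝ × (Fin n → ℝ) => (Fin.cons p.1 p.2 : Fin (n + 1) → ℝ) := by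
  refine measurable_pi_lambda _ fun i => Fin.cases ?_ (fun j => ?_) i
  · simpa using measurable_fst
  · simpa [Function.comp_def] using (measurable_pi_apply j).comp measurable_snd

/-- The Prékopa–Leindler inequality on `ℝⁿ`, for midpoints. -/
theorem prekopa_leindler_pi {n : ℕ} {f g h : (Fin n → ℝ) → ENNReal} (hf : Measurable f)
    (hg : Measurable g) (hh : Measurable h)
    (hfgh : ∀ x y, f x * g y ≤ h ((2⁻¹ : ℝ) • (x + y)) ^ 2) :
    (∫⁻ x, f x) * ∫⁻ x, g x ≤ (∫⁻ x, h x) ^ 2 := by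
  induction n with
  | zero =>
    simp only [volume_pi, Measure.pi_of_empty (fun _ => volume) 0, lintegral_dirac]
    simpa using hfgh 0 0
  | succ n ih =>
    rw [lintegral_fin_succ hf, lintegral_fin_succ hg, lintegral_fin_succ hh]
    have hslice : ∀ {u : (Fin (n + 1) → ℝ) → ENNReal}, Measurable u →
        Measurable fun t : ℝ => ∫⁻ x : Fin n → ℝ, u (Fin.cons t x) :=
      fun hu => (hu.comp measurable_finCons).lintegral_prod_right'
    have hcons : ∀ t : ℝ, Measurable fun x : Fin n → ℝ => (Fin.cons t x : Fin (n + 1) → ℝ) :=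
      fun t => measurable_finCons.comp measurable_prodMk_left
    refine prekopa_leindler_real (hslice hf) (hslice hg) (hslice hh) fun s t => ?_
    refine ih (hf.comp (hcons s)) (hg.comp (hcons t)) (hh.comp (hcons _)) fun x y => ?_
    convert hfgh (Fin.cons s x) (Fin.cons t y) using 3
    ext i
    refine Fin.cases ?_ (fun j => ?_) i <;> simp [mul_add]

/-- The Prékopa–Leindler inequality on Euclidean space, for midpoints. -/
theorem prekopa_leindler {n : ℕ} {f g h : EuclideanSpace ℝ (Fin n) → ENNReal}
    (hf : Measurable f) (hg : Measurable g) (hh : Measurable h)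
    (hfgh : ∀ x y, f x * g y ≤ h ((2⁻¹ : ℝ) • (x + y)) ^ 2) :
    (∫⁻ x, f x) * ∫⁻ x, g x ≤ (∫⁻ x, h x) ^ 2 := by
  have hp := PiLp.volume_preserving_toLp (Fin n)
  rw [← hp.lintegral_comp hf, ← hp.lintegral_comp hg, ← hp.lintegral_comp hh]
  exact prekopa_leindler_pi (hf.comp hp.measurable) (hg.comp hp.measurable)
    (hh.comp hp.measurable) fun x y => hfgh _ _

theorem lintegral_stdGaussian_density (n : ℕ) :
    ∫⁻ x : EuclideanSpace ℝ (Fin n),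
      ENNReal.ofReal ((2 * Real.pi) ^ (-(n : ℝ) / 2) * Real.exp (-‖x‖ ^ 2 / 2)) = 1 := by
  have hint : ∫ x : EuclideanSpace ℝ (Fin n),
      (2 * Real.pi) ^ (-(n : ℝ) / 2) * Real.exp (-‖x‖ ^ 2 / 2) = 1 := by
    have h := GaussianFourier.integral_rexp_neg_mul_sq_norm (V := EuclideanSpace ℝ (Fin n))
      (b := 2⁻¹) (by norm_num)
    rw [finrank_euclideanSpace_fin, div_inv_eq_mul, mul_comm Real.pi] at h
    rw [integral_const_mul]
    simp_rw [show ∀ r : ℝ, -r ^ 2 / 2 = -2⁻¹ * r ^ 2 from fun r => by ring]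
    rw [h, ← Real.rpow_add (by positivity), neg_div, neg_add_cancel, Real.rpow_zero]
  rw [← ofReal_integral_eq_lintegral_ofReal, hint, ENNReal.ofReal_one]
  · exact .of_integral_ne_zero (by rw [hint]; exact one_ne_zero)
  · exact .of_forall fun x => by positivity

/-- If two Borel sets `A`, `B` are `ε`-separated in the Euclidean distance,
then `μ(A)·μ(B) ≤ exp(-ε²/4)`. -/
theorem gaussian_separated_sets (n : ℕ) (hn : 1 ≤ n)
    (A B : Set (EuclideanSpace ℝ (Fin n)))
    (hA : MeasurableSet A) (hB : MeasurableSet B)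
    (ε : ℝ) (hε : 0 < ε)
    (hsep : ∀ a ∈ A, ∀ b ∈ B, ε ≤ ‖a - b‖) :
    stdGaussian n A * stdGaussian n B
      ≤ ENNReal.ofReal (Real.exp (-ε ^ 2 / 4)) := by
  set c : ℝ := (2 * Real.pi) ^ (-(n : ℝ) / 2) with hc
  set γ : EuclideanSpace ℝ (Fin n) → ENNReal :=
    fun x => ENNReal.ofReal (c * Real.exp (-‖x‖ ^ 2 / 2)) with hγ
  have hγm : Measurable γ := by fun_prop
  have hc₀ : 0 ≤ c := by positivity
  have hpl := prekopa_leindler (h := fun x => ENNReal.ofReal (Real.exp (-ε ^ 2 / 8)) * γ x)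
    (hγm.indicator hA) (hγm.indicator hB) (hγm.const_mul _) fun x y => by
      by_cases hx : x ∈ A
      swap; · simp [hx]
      by_cases hy : y ∈ B
      swap; · simp [hy]
      simp only [Set.indicator_of_mem hx, Set.indicator_of_mem hy, hγ]
      rw [← ENNReal.ofReal_mul (by positivity), ← ENNReal.ofReal_mul (by positivity),
        ← ENNReal.ofReal_pow (by positivity)]
      refine ENNReal.ofReal_le_ofReal ?_
      have hpar := parallelogram_law_with_norm ℝ x y
      have hxy : ε ^ 2 ≤ ‖x - y‖ ^ 2 := pow_le_pow_left₀ hε.le (hsep x hx y hy) 2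
      have hmid : ‖(2⁻¹ : ℝ) • (x + y)‖ ^ 2 = ‖x + y‖ ^ 2 / 4 := by
        rw [norm_smul, mul_pow]
        norm_num
        ring
      calc c * Real.exp (-‖x‖ ^ 2 / 2) * (c * Real.exp (-‖y‖ ^ 2 / 2))
          = c ^ 2 * Real.exp (-‖x‖ ^ 2 / 2 + -‖y‖ ^ 2 / 2) := by rw [Real.exp_add]; ring
        _ ≤ c ^ 2 * Real.exp (2 * (-ε ^ 2 / 8 + -(‖x + y‖ ^ 2 / 4) / 2)) := by
          gcongr
          nlinarith
        _ = _ := by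
          rw [hmid, two_mul, Real.exp_add, Real.exp_add]
          ring
  rw [lintegral_indicator hA, lintegral_indicator hB, lintegral_const_mul _ hγm,
    lintegral_stdGaussian_density, mul_one, ← ENNReal.ofReal_pow (by positivity),
    ← Real.exp_nat_mul] at hpl
  rw [stdGaussian, withDensity_apply _ hA, withDensity_apply _ hB]
  convert hpl using 3
  push_cast
  ring
end

section
/- Let E be a real Banach space and let (P_t)_{t ≥ 0} be a family of bounded linear operators on E satisfying P_0 = I, P_{t+s} = P_t ∘ P_s for all s, t ≥ 0, and ‖P_t‖ ≤ 1 (operator norm) for all t ≥ 0. Let G ∈ E be such that t ↦ P_t G is continuous from [0,∞) to E. Then the Bochner integrals g := ∫₀^∞ e^{−t} P_t G dt and R := ∫₀^∞ t^{−1/2} e^{−t} P_t G dt converge absolutely, and the interpolation inequality ‖R‖ ≤ 4 · ‖G‖^{1/2} · ‖g‖^{1/2} holds. -/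
open MeasureTheory

open Set Filter Topology

/-- Optimizing `s ↦ 2 (s a + b / s)` over `s > 0`. -/
lemma le_four_mul_sqrt_mul_sqrt {r a b : ℝ} (ha : 0 ≤ a) (hb : 0 ≤ b)
    (h : ∀ s : ℝ, 0 < s → r ≤ 2 * s * a + 2 * b / s) :
    r ≤ 4 * (Real.sqrt a * Real.sqrt b) := by
  have hlim : Tendsto (fun ε : ℝ => 4 * (Real.sqrt (a + ε) * Real.sqrt (b + ε))) (𝓝[>] 0)
      (𝓝 (4 * (Real.sqrt a * Real.sqrt b))) := by
    have hc : Continuous fun ε : ℝ => 4 * (Real.sqrt (a + ε) * Real.sqrt (b + ε)) := by fun_prop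
    simpa using (hc.tendsto 0).mono_left nhdsWithin_le_nhds
  refine ge_of_tendsto hlim ?_
  filter_upwards [self_mem_nhdsWithin] with ε hε
  have hε : 0 < ε := hε
  have hx : 0 < Real.sqrt (a + ε) := Real.sqrt_pos.2 (by linarith)
  have hy : 0 < Real.sqrt (b + ε) := Real.sqrt_pos.2 (by linarith)
  have hx2 : Real.sqrt (a + ε) ^ 2 = a + ε := Real.sq_sqrt (by linarith)
  have hy2 : Real.sqrt (b + ε) ^ 2 = b + ε := Real.sq_sqrt (by linarith)
  set x := Real.sqrt (a + ε)
  set y := Real.sqrt (b + ε)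
  calc r ≤ 2 * (y / x) * a + 2 * b / (y / x) := h _ (by positivity)
    _ ≤ 2 * (y / x) * x ^ 2 + 2 * y ^ 2 / (y / x) := by
        gcongr <;> linarith
    _ = 4 * (x * y) := by field_simp; ring

section Tail

variable {E : Type*} [NormedAddCommGroup E] [NormedSpace ℝ E] [CompleteSpace E] {F : ℝ → E}

lemma hasDerivAt_integral_Ioi (hF : ContinuousOn F (Ioi 0)) (hFint : IntegrableOn F (Ioi 0))
    {t : ℝ} (ht : 0 < t) : HasDerivAt (fun u => ∫ x in Ioi u, F x) (-F t) t := by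
  have hII : IntervalIntegrable F volume 0 t :=
    (intervalIntegrable_iff_integrableOn_Ioc_of_le ht.le).2 (hFint.mono_set Ioc_subset_Ioi_self)
  have hd : HasDerivAt (fun u => ∫ x in (0 : ℝ)..u, F x) (F t) t :=
    intervalIntegral.integral_hasDerivAt_right hII
      (hF.stronglyMeasurableAtFilter isOpen_Ioi t ht) (hF.continuousAt (Ioi_mem_nhds ht))
  refine (hd.const_sub (∫ x in Ioi 0, F x)).congr_of_eventuallyEq ?_
  filter_upwards [Ioi_mem_nhds ht] with u hu
  rw [← intervalIntegral.integral_Ioi_sub_Ioi hFint (le_of_lt hu), sub_sub_cancel]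

/-- Integration by parts against `t ^ (-1/2)`, away from the origin. -/
lemma norm_setIntegral_Ioi_rpow_smul_le {b δ : ℝ} (hδ : 0 < δ)
    (hF : ContinuousOn F (Ioi 0)) (hFint : IntegrableOn F (Ioi 0))
    (hFint' : IntegrableOn (fun t : ℝ => t ^ (-(1 : ℝ) / 2) • F t) (Ioi 0))
    (hb : ∀ t, 0 < t → ‖∫ x in Ioi t, F x‖ ≤ b) :
    ‖∫ t in Ioi δ, t ^ (-(1 : ℝ) / 2) • F t‖ ≤ 2 * b * δ ^ (-(1 : ℝ) / 2) := by
  set U : ℝ → E := fun u => ∫ x in Ioi u, F x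
  have hUd : ∀ t, 0 < t → HasDerivAt U (-F t) t := fun t ht => hasDerivAt_integral_Ioi hF hFint ht
  have hsub : Ioi δ ⊆ Ioi (0 : ℝ) := Ioi_subset_Ioi hδ.le
  have hpow : IntegrableOn (fun t : ℝ => t ^ (-(3 : ℝ) / 2) * b) (Ioi δ) :=
    (integrableOn_Ioi_rpow_of_lt (by norm_num) hδ).mul_const b
  have hle : ∀ᵐ t ∂volume.restrict (Ioi δ),
      ‖t ^ (-(3 : ℝ) / 2) • U t‖ ≤ t ^ (-(3 : ℝ) / 2) * b := by
    filter_upwards [ae_restrict_mem measurableSet_Ioi] with t ht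
    have ht0 : 0 < t := hsub ht
    rw [norm_smul, Real.norm_of_nonneg (by positivity)]
    gcongr
    exact hb t ht0
  have hUint : IntegrableOn (fun t : ℝ => t ^ (-(3 : ℝ) / 2) • U t) (Ioi δ) := by
    refine hpow.mono' (ContinuousOn.aestronglyMeasurable (fun t ht => ?_) measurableSet_Ioi) hle
    have ht0 : 0 < t := hsub ht
    exact ((Real.continuousAt_rpow_const _ _ (Or.inl ht0.ne')).smul
      (hUd t ht0).continuousAt).continuousWithinAt
  have hUnorm : ‖∫ t in Ioi δ, t ^ (-(3 : ℝ) / 2) • U t‖ ≤ 2 * δ ^ (-(1 : ℝ) / 2) * b := by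
    refine (norm_integral_le_of_norm_le hpow hle).trans_eq ?_
    rw [integral_mul_const, integral_Ioi_rpow_of_lt (by norm_num) hδ,
      show -(3 : ℝ) / 2 + 1 = -1 / 2 by norm_num]
    ring
  have hlim : Tendsto (fun t : ℝ => t ^ (-(1 : ℝ) / 2) • U t) atTop (𝓝 0) := by
    have h0 : Tendsto (fun t : ℝ => t ^ (-(1 : ℝ) / 2) * b) atTop (𝓝 0) := by
      simpa [neg_div] using
        (tendsto_rpow_neg_atTop (y := 1 / 2) (by norm_num)).mul_const b
    refine squeeze_zero_norm' ?_ h0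
    filter_upwards [eventually_gt_atTop 0] with t ht
    rw [norm_smul, Real.norm_of_nonneg (by positivity)]
    gcongr
    exact hb t ht
  have hFneg : IntegrableOn (fun t : ℝ => -(t ^ (-(1 : ℝ) / 2) • F t)) (Ioi δ) :=
    (hFint'.mono_set hsub).neg
  have hUsmul : IntegrableOn (fun t : ℝ => (-(1 : ℝ) / 2) • t ^ (-(3 : ℝ) / 2) • U t) (Ioi δ) :=
    hUint.smul _
  have hparts := integral_Ioi_of_hasDerivAt_of_tendsto' (a := δ) (m := 0)
    (f := fun t : ℝ => t ^ (-(1 : ℝ) / 2) • U t)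
    (f' := fun t : ℝ => -(t ^ (-(1 : ℝ) / 2) • F t) + (-(1 : ℝ) / 2) • t ^ (-(3 : ℝ) / 2) • U t)
    (fun t ht => by
      have ht0 : 0 < t := hδ.trans_le ht
      refine ((Real.hasDerivAt_rpow_const (p := -(1 : ℝ) / 2) (Or.inl ht0.ne')).smul
        (hUd t ht0)).congr_deriv ?_
      rw [smul_neg, smul_smul, show -(1 : ℝ) / 2 - 1 = -3 / 2 by norm_num])
    (hFneg.add hUsmul) hlim
  rw [integral_add hFneg hUsmul, integral_neg, integral_smul] at hparts
  have hEq : ∫ t in Ioi δ, t ^ (-(1 : ℝ) / 2) • F t =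
      δ ^ (-(1 : ℝ) / 2) • U δ + (-(1 : ℝ) / 2) • ∫ t in Ioi δ, t ^ (-(3 : ℝ) / 2) • U t := by
    rw [zero_sub, neg_add_eq_iff_eq_add, ← sub_eq_add_neg, eq_sub_iff_add_eq] at hparts
    rw [← hparts, add_comm]
  rw [hEq]
  calc _ ≤ δ ^ (-(1 : ℝ) / 2) * b + 1 / 2 * (2 * δ ^ (-(1 : ℝ) / 2) * b) := by
        refine (norm_add_le _ _).trans (add_le_add ?_ ?_)
        · rw [norm_smul, Real.norm_of_nonneg (by positivity)]
          gcongr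
          exact hb δ hδ
        · rw [norm_smul, show ‖-(1 : ℝ) / 2‖ = 1 / 2 by norm_num]
          gcongr
    _ = _ := by ring

/-- A function bounded by `a` whose tail integrals are bounded by `b` has half-order integral
bounded by `4 √a √b`. -/
lemma norm_integral_rpow_smul_le {a b : ℝ}
    (hF : ContinuousOn F (Ioi 0)) (hFint : IntegrableOn F (Ioi 0))
    (hFint' : IntegrableOn (fun t : ℝ => t ^ (-(1 : ℝ) / 2) • F t) (Ioi 0))
    (ha : ∀ t, 0 < t → ‖F t‖ ≤ a) (hb : ∀ t, 0 < t → ‖∫ x in Ioi t, F x‖ ≤ b) :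
    ‖∫ t in Ioi (0 : ℝ), t ^ (-(1 : ℝ) / 2) • F t‖ ≤ 4 * (Real.sqrt a * Real.sqrt b) := by
  refine le_four_mul_sqrt_mul_sqrt ((norm_nonneg _).trans (ha 1 one_pos))
    ((norm_nonneg _).trans (hb 1 one_pos)) fun s hs => ?_
  have hδ : 0 < s ^ 2 := by positivity
  have hs1 : (s ^ 2) ^ ((1 : ℝ) / 2) = s := by
    rw [← Real.sqrt_eq_rpow, Real.sqrt_sq hs.le]
  have hs2 : (s ^ 2) ^ (-(1 : ℝ) / 2) = s⁻¹ := by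
    rw [neg_div, Real.rpow_neg hδ.le, hs1]
  have hnear : ‖∫ t in (0 : ℝ)..s ^ 2, t ^ (-(1 : ℝ) / 2) • F t‖ ≤ 2 * s * a := by
    have hr : IntervalIntegrable (fun t : ℝ => t ^ (-(1 : ℝ) / 2) * a) volume 0 (s ^ 2) :=
      (intervalIntegral.intervalIntegrable_rpow' (by norm_num)).mul_const a
    refine (intervalIntegral.norm_integral_le_of_norm_le hδ.le
      (Eventually.of_forall fun t ht => ?_) hr).trans_eq ?_
    · have ht0 : 0 < t := ht.1
      rw [norm_smul, Real.norm_of_nonneg (by positivity)]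
      gcongr
      exact ha t ht0
    · rw [intervalIntegral.integral_mul_const, integral_rpow (Or.inl (by norm_num)),
        show -(1 : ℝ) / 2 + 1 = 1 / 2 by norm_num, hs1, Real.zero_rpow (by norm_num)]
      ring
  have hfar := norm_setIntegral_Ioi_rpow_smul_le hδ hF hFint hFint' hb
  rw [hs2, ← div_eq_mul_inv] at hfar
  rw [← sub_add_cancel (∫ t in Ioi (0 : ℝ), t ^ (-(1 : ℝ) / 2) • F t)
    (∫ t in Ioi (s ^ 2), t ^ (-(1 : ℝ) / 2) • F t),
    intervalIntegral.integral_Ioi_sub_Ioi hFint' hδ.le]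
  exact (norm_add_le _ _).trans (add_le_add hnear hfar)

end Tail

/-- Interpolation inequality for contraction semigroups on a Banach space:
with `g = ∫₀^∞ e^{-t} P_t G dt` and `R = ∫₀^∞ t^{-1/2} e^{-t} P_t G dt`, both
integrals converge absolutely and `‖R‖ ≤ 4 ‖G‖^{1/2} ‖g‖^{1/2}`. -/
theorem semigroup_interpolation (E : Type*) [NormedAddCommGroup E]
    [NormedSpace ℝ E] [CompleteSpace E]
    (P : ℝ → E →L[ℝ] E)
    (hP0 : P 0 = ContinuousLinearMap.id ℝ E)
    (hPsemi : ∀ s t : ℝ, 0 ≤ s → 0 ≤ t → P (t + s) = (P t).comp (P s))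
    (hPnorm : ∀ t : ℝ, 0 ≤ t → ‖P t‖ ≤ 1)
    (G : E) (hcont : ContinuousOn (fun t => P t G) (Set.Ici (0 : ℝ))) :
    IntegrableOn (fun t => Real.exp (-t) • P t G) (Set.Ioi (0 : ℝ)) volume ∧
    IntegrableOn (fun t => (t ^ (-(1 : ℝ) / 2) * Real.exp (-t)) • P t G)
      (Set.Ioi (0 : ℝ)) volume ∧
    ‖∫ t in Set.Ioi (0 : ℝ), (t ^ (-(1 : ℝ) / 2) * Real.exp (-t)) • P t G‖
      ≤ 4 * (Real.sqrt ‖G‖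
          * Real.sqrt ‖∫ t in Set.Ioi (0 : ℝ), Real.exp (-t) • P t G‖) := by
  have hbound : ∀ t, 0 ≤ t → ∀ x, ‖P t x‖ ≤ ‖x‖ := fun t ht x => by
    simpa using (P t).le_of_opNorm_le (hPnorm t ht) x
  have hcont' : ContinuousOn (fun t => P t G) (Ioi 0) := hcont.mono Ioi_subset_Ici_self
  have hsmul : ∀ w : ℝ → ℝ, IntegrableOn w (Ioi 0) →
      IntegrableOn (fun t => w t • P t G) (Ioi 0) := fun w hw => by
    refine Integrable.smul_bdd hw ‖G‖ (hcont'.aestronglyMeasurable measurableSet_Ioi) ?_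
    filter_upwards [ae_restrict_mem measurableSet_Ioi] with t ht
    exact hbound t (le_of_lt ht) G
  have hFint : IntegrableOn (fun t => Real.exp (-t) • P t G) (Ioi 0) :=
    hsmul _ (integrableOn_exp_neg_Ioi 0)
  have hFint' : IntegrableOn (fun t => (t ^ (-(1 : ℝ) / 2) * Real.exp (-t)) • P t G) (Ioi 0) := by
    refine hsmul _ ?_
    refine (Real.GammaIntegral_convergent (s := 1 / 2) (by norm_num)).congr_fun (fun t _ => ?_)
      measurableSet_Ioi
    simp only [mul_comm, show (1 : ℝ) / 2 - 1 = -1 / 2 by norm_num]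
  refine ⟨hFint, hFint', ?_⟩
  simp_rw [mul_smul] at hFint' ⊢
  have hexp : ∀ t : ℝ, 0 ≤ t → ∀ x : E, ‖Real.exp (-t) • P t x‖ ≤ ‖x‖ := fun t ht x => by
    rw [norm_smul, Real.norm_of_nonneg (Real.exp_pos _).le]
    exact (mul_le_of_le_one_left (norm_nonneg _) (Real.exp_le_one_iff.2 (by linarith))).trans
      (hbound t ht x)
  refine norm_integral_rpow_smul_le (F := fun t => Real.exp (-t) • P t G)
    (ContinuousOn.smul (by fun_prop) hcont') hFint hFint' (fun t ht => hexp t ht.le G)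
    fun t ht => ?_
  have hshift : ∫ s in Ioi t, Real.exp (-s) • P s G =
      Real.exp (-t) • P t (∫ s in Ioi (0 : ℝ), Real.exp (-s) • P s G) := by
    rw [← (measurePreserving_add_left volume t).setIntegral_preimage_emb
      (measurableEmbedding_addLeft t), ← (P t).integral_comp_comm hFint, ← integral_smul]
    simp only [preimage_const_add_Ioi, sub_self]
    refine setIntegral_congr_fun measurableSet_Ioi fun s hs => ?_
    simp only [map_smul, smul_smul, hPsemi s t (le_of_lt hs) ht.le, neg_add, Real.exp_add,
      ContinuousLinearMap.comp_apply]
  rw [hshift]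
  exact hexp t ht.le _
end

section
/- Let n ≥ 1 be an integer, let p, q > 1 with 1/p + 1/q = 1, and let f, g : ℝⁿ → ℝ be convex functions such that |f|^p, ‖∇f‖^p, |g|^q and ‖∇g‖^q are integrable with respect to μ, where ∇f and ∇g denote the Lebesgue-almost everywhere defined gradients of f and g (set equal to 0 at points of non-differentiability). Then ∫_{ℝⁿ} f·g dμ ≥ (∫ f dμ)·(∫ g dμ) + ⟨∫ ∇f dμ, ∫ ∇g dμ⟩. -/
open MeasureTheory
open scoped RealInnerProductSpace

lemma integrable_stdGaussian_density (n : ℕ) :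
    Integrable fun x : EuclideanSpace ℝ (Fin n) =>
      (2 * Real.pi) ^ (-(n : ℝ) / 2) * Real.exp (-‖x‖ ^ 2 / 2) := by
  refine Integrable.const_mul ?_ _
  have h := (GaussianFourier.integrable_cexp_neg_mul_sq_norm_add
    (V := EuclideanSpace ℝ (Fin n)) (b := 1 / 2) (by norm_num) 0 0).norm
  refine h.congr (Filter.Eventually.of_forall fun x => ?_)
  simp only [Complex.norm_exp]
  congr 1
  simp [← Complex.ofReal_pow]
  ring

instance isFiniteMeasure_stdGaussian (n : ℕ) : IsFiniteMeasure (stdGaussian n) :=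
  isFiniteMeasure_withDensity_ofReal (integrable_stdGaussian_density n).2

lemma integral_stdGaussian {F : Type*} [NormedAddCommGroup F] [NormedSpace ℝ F] (n : ℕ)
    (f : EuclideanSpace ℝ (Fin n) → F) :
    ∫ x, f x ∂stdGaussian n =
      ∫ x, ((2 * Real.pi) ^ (-(n : ℝ) / 2) * Real.exp (-‖x‖ ^ 2 / 2)) • f x := by
  rw [stdGaussian, integral_withDensity_eq_integral_toReal_smul (by fun_prop) (by simp)]
  refine integral_congr_ae (Filter.Eventually.of_forall fun x => ?_)
  simp only
  rw [ENNReal.toReal_ofReal (by positivity)]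

lemma integrable_stdGaussian_iff {n : ℕ} {k : EuclideanSpace ℝ (Fin n) → ℝ} :
    Integrable k (stdGaussian n) ↔ Integrable fun x =>
      k x * ((2 * Real.pi) ^ (-(n : ℝ) / 2) * Real.exp (-‖x‖ ^ 2 / 2)) := by
  rw [stdGaussian, integrable_withDensity_iff (by fun_prop) (by simp)]
  refine integrable_congr (Filter.Eventually.of_forall fun x => ?_)
  simp only
  rw [ENNReal.toReal_ofReal (by positivity)]

lemma stdGaussian_eq (n : ℕ) :
    stdGaussian n = ProbabilityTheory.stdGaussian (EuclideanSpace ℝ (Fin n)) := by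
  refine Measure.ext_of_charFun ?_
  ext t
  rw [ProbabilityTheory.charFun_stdGaussian, charFun_apply, integral_stdGaussian]
  have h := GaussianFourier.integral_cexp_neg_mul_sq_norm_add
    (V := EuclideanSpace ℝ (Fin n)) (b := 1 / 2) (by norm_num) Complex.I t
  have h2 : ∀ x : EuclideanSpace ℝ (Fin n),
      ((2 * Real.pi) ^ (-(n : ℝ) / 2) * Real.exp (-‖x‖ ^ 2 / 2)) •
        Complex.exp (⟪x, t⟫ * Complex.I) =
      (((2 * Real.pi) ^ (-(n : ℝ) / 2) : ℝ) : ℂ) *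
        Complex.exp (-(1 / 2) * ‖x‖ ^ 2 + Complex.I * ⟪t, x⟫) := by
    intro x
    rw [Complex.real_smul, Complex.exp_add, real_inner_comm]
    push_cast
    rw [mul_assoc]
    congr 3
    · ring
    · ring
  simp_rw [h2]
  rw [integral_const_mul, h]
  have h3 : (((2 * Real.pi) ^ (-(n : ℝ) / 2) : ℝ) : ℂ) *
      ((Real.pi : ℂ) / (1 / 2)) ^
        ((Module.finrank ℝ (EuclideanSpace ℝ (Fin n)) : ℂ) / 2) = 1 := by
    rw [show ((Real.pi : ℂ) / (1 / 2)) = ((2 * Real.pi : ℝ) : ℂ) by push_cast; ring,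
      show ((Module.finrank ℝ (EuclideanSpace ℝ (Fin n)) : ℂ) / 2) = ((n / 2 : ℝ) : ℂ) by simp,
      ← Complex.ofReal_cpow (by positivity), ← Complex.ofReal_mul,
      ← Real.rpow_add (by positivity)]
    simp [neg_div]
  rw [← mul_assoc, h3, one_mul]
  congr 1
  rw [Complex.I_sq]
  ring

instance isGaussian_stdGaussian (n : ℕ) : ProbabilityTheory.IsGaussian (stdGaussian n) := by
  rw [stdGaussian_eq]
  infer_instance

/-- The standard Gaussian measure on the product is invariant under rotations. -/
lemma measurePreserving_rotation_stdGaussian (n : ℕ) (θ : ℝ) :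
    MeasurePreserving (ContinuousLinearMap.rotation θ)
      ((stdGaussian n).prod (stdGaussian n)) ((stdGaussian n).prod (stdGaussian n)) := by
  refine ⟨by fun_prop, ProbabilityTheory.IsGaussian.map_rotation_eq_self ?_ θ⟩
  rw [stdGaussian_eq]
  exact ProbabilityTheory.integral_id_stdGaussian

lemma memLp_norm_stdGaussian (n : ℕ) {p : ENNReal} (hp : p ≠ ⊤) :
    MemLp (fun x : EuclideanSpace ℝ (Fin n) => ‖x‖) p (stdGaussian n) :=
  (ProbabilityTheory.IsGaussian.memLp_id (stdGaussian n) p hp).norm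

/-- Gaussian integration by parts for smooth functions with bounded derivative. -/
lemma integral_inner_mul_stdGaussian {n : ℕ} {h : EuclideanSpace ℝ (Fin n) → ℝ}
    (hd : Differentiable ℝ h) (hi : Integrable h (stdGaussian n))
    (u : EuclideanSpace ℝ (Fin n))
    (hu : Integrable (fun x => h x * ⟪u, x⟫) (stdGaussian n))
    (hu' : Integrable (fun x => fderiv ℝ h x u) (stdGaussian n)) :
    ∫ x, h x * ⟪u, x⟫ ∂stdGaussian n = ∫ x, fderiv ℝ h x u ∂stdGaussian n := by
  set ρ : EuclideanSpace ℝ (Fin n) → ℝ := fun x =>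
    (2 * Real.pi) ^ (-(n : ℝ) / 2) * Real.exp (-‖x‖ ^ 2 / 2) with hρ
  have key : ∀ k : EuclideanSpace ℝ (Fin n) → ℝ, Integrable k (stdGaussian n) →
      Integrable (fun x => k x * ρ x) := fun k => integrable_stdGaussian_iff.1
  have hρd : ∀ x, HasFDerivAt ρ (-(ρ x) • innerSL ℝ x) x := by
    intro x
    have h1 : HasFDerivAt (fun x : EuclideanSpace ℝ (Fin n) => ‖x‖ ^ 2) (2 • innerSL ℝ x) x :=
      (hasStrictFDerivAt_norm_sq x).hasFDerivAt
    have h2 := ((h1.const_mul (-(1 / 2 : ℝ))).exp).const_mul ((2 * Real.pi) ^ (-(n : ℝ) / 2))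
    have h3 : ρ = fun y => (2 * Real.pi) ^ (-(n : ℝ) / 2) * Real.exp (-(1 / 2) * ‖y‖ ^ 2) := by
      ext y
      simp only [hρ]
      ring_nf
    rw [h3]
    refine h2.congr_fderiv ?_
    ext y
    simp
    ring
  have hρu : ∀ x, fderiv ℝ ρ x u = -(ρ x) * ⟪u, x⟫ := by
    intro x
    rw [(hρd x).fderiv]
    simp [real_inner_comm]
  have hh := integral_mul_fderiv_eq_neg_fderiv_mul_of_integrable (μ := volume) (f := h) (g := ρ)
    (v := u) (key _ hu') (by
      refine (key _ hu).neg.congr (Filter.Eventually.of_forall fun x => ?_)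
      simp only [hρu, Pi.neg_apply]; ring) (key _ hi)
    (fun x _ => hd x) (fun x _ => (hρd x).differentiableAt)
  rw [integral_stdGaussian, integral_stdGaussian]
  simp only [hρu] at hh
  calc _ = - ∫ x, h x * (-(ρ x) * ⟪u, x⟫) := by
        rw [← integral_neg]
        refine integral_congr_ae (Filter.Eventually.of_forall fun x => ?_)
        simp only [smul_eq_mul, hρ]; ring
    _ = _ := by
        rw [hh, neg_neg]
        refine integral_congr_ae (Filter.Eventually.of_forall fun x => ?_)
        simp only [smul_eq_mul, hρ]; ring

lemma integrable_of_abs_le_sq_growth {V : Type*} [NormedAddCommGroup V] [NormedSpace ℝ V]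
    [MeasurableSpace V] [BorelSpace V] [SecondCountableTopology V] [CompleteSpace V]
    {ν : Measure V} [ProbabilityTheory.IsGaussian ν] {h : V → ℝ}
    (hm : AEStronglyMeasurable h ν) {C : ℝ} (hC : ∀ x, |h x| ≤ C * (1 + ‖x‖) ^ 2) :
    Integrable h ν := by
  have h0 : MemLp (fun x : V => ‖x‖) 2 ν :=
    (ProbabilityTheory.IsGaussian.memLp_id ν 2 (by simp)).norm
  have h1 : MemLp (fun x : V => 1 + ‖x‖) 2 ν := (memLp_const (1 : ℝ)).add h0
  exact (h1.integrable_sq.const_mul C).mono' hm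
    (Filter.Eventually.of_forall fun x => by simpa using hC x)

lemma LipschitzWith.exists_abs_le_growth {V : Type*} [NormedAddCommGroup V] {K : NNReal}
    {a : V → ℝ} (ha : LipschitzWith K a) : ∃ C, 0 ≤ C ∧ ∀ x, |a x| ≤ C * (1 + ‖x‖) := by
  refine ⟨|a 0| + K, by positivity, fun x => ?_⟩
  have h1 := ha.dist_le_mul x 0
  rw [Real.dist_eq, dist_zero_right] at h1
  have h2 : |a x| ≤ |a 0| + |a x - a 0| := by
    have := abs_add_le (a 0) (a x - a 0)
    simpa using this
  nlinarith [norm_nonneg x, abs_nonneg (a 0), K.2, mul_nonneg (abs_nonneg (a 0)) (norm_nonneg x)]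

lemma apply_toDual_symm_eq_sum {n : ℕ} (L M : EuclideanSpace ℝ (Fin n) →L[ℝ] ℝ) :
    L ((InnerProductSpace.toDual ℝ _).symm M) =
      ∑ i, L (EuclideanSpace.single i 1) * M (EuclideanSpace.single i 1) := by
  conv_lhs => rw [← (EuclideanSpace.basisFun (Fin n) ℝ).sum_repr'
    ((InnerProductSpace.toDual ℝ _).symm M)]
  rw [map_sum]
  refine Finset.sum_congr rfl fun i _ => ?_
  rw [map_smul, real_inner_comm, InnerProductSpace.toDual_symm_apply, smul_eq_mul, mul_comm,
    EuclideanSpace.basisFun_apply]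

lemma integral_mul_fderiv_rotation {n : ℕ} {a b : EuclideanSpace ℝ (Fin n) → ℝ}
    (ha : ContDiff ℝ 1 a) (hb : ContDiff ℝ 1 b) {A B : NNReal}
    (hA : LipschitzWith A a) (hB : LipschitzWith B b) (θ : ℝ) :
    ∫ z, a z.1 * fderiv ℝ b (Real.cos θ • z.1 + Real.sin θ • z.2)
        (-Real.sin θ • z.1 + Real.cos θ • z.2) ∂(stdGaussian n).prod (stdGaussian n) =
      -Real.sin θ * ∫ z, ∑ i, fderiv ℝ a z.1 (EuclideanSpace.single i 1) *
        fderiv ℝ b (Real.cos θ • z.1 + Real.sin θ • z.2) (EuclideanSpace.single i 1)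
        ∂(stdGaussian n).prod (stdGaussian n) := by
  have hrot := measurePreserving_rotation_stdGaussian n θ
  have hda : Continuous (fderiv ℝ a) := ha.continuous_fderiv (by norm_num)
  have hdb : Continuous (fderiv ℝ b) := hb.continuous_fderiv (by norm_num)
  have hca : Continuous a := ha.continuous
  obtain ⟨C, hC0, hC⟩ := hA.exists_abs_le_growth
  have hnA : ∀ x, ‖fderiv ℝ a x‖ ≤ A := fun x => norm_fderiv_le_of_lipschitz ℝ hA
  have hnB : ∀ x, ‖fderiv ℝ b x‖ ≤ B := fun x => norm_fderiv_le_of_lipschitz ℝ hB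
  have hcs : ∀ x y : EuclideanSpace ℝ (Fin n),
      ‖Real.cos θ • x - Real.sin θ • y‖ ≤ ‖x‖ + ‖y‖ := by
    intro x y
    refine (norm_sub_le _ _).trans (add_le_add ?_ ?_)
    · rw [norm_smul]
      exact mul_le_of_le_one_left (norm_nonneg _) (Real.abs_cos_le_one θ)
    · rw [norm_smul]
      exact mul_le_of_le_one_left (norm_nonneg _) (Real.abs_sin_le_one θ)
  set e : Fin n → EuclideanSpace ℝ (Fin n) := fun i => EuclideanSpace.single i 1 with he
  let Φ : EuclideanSpace ℝ (Fin n) × EuclideanSpace ℝ (Fin n) → ℝ := fun z =>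
    a (Real.cos θ • z.1 - Real.sin θ • z.2) * fderiv ℝ b z.1 z.2
  let Ψ : EuclideanSpace ℝ (Fin n) × EuclideanSpace ℝ (Fin n) → ℝ := fun z =>
    ∑ i, fderiv ℝ a (Real.cos θ • z.1 - Real.sin θ • z.2) (e i) * fderiv ℝ b z.1 (e i)
  have hΦc : Continuous Φ := by
    refine Continuous.mul (by fun_prop) ?_
    exact (hdb.comp continuous_fst).clm_apply continuous_snd
  have hΨc : Continuous Ψ := by
    refine continuous_finsetSum _ fun i _ => Continuous.mul ?_ ?_
    · exact (hda.comp (by fun_prop)).clm_apply continuous_const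
    · exact (hdb.comp continuous_fst).clm_apply continuous_const
  have hbase : ∀ z : EuclideanSpace ℝ (Fin n) × EuclideanSpace ℝ (Fin n),
      Real.cos θ • (Real.cos θ • z.1 + Real.sin θ • z.2) -
        Real.sin θ • (-Real.sin θ • z.1 + Real.cos θ • z.2) = z.1 := by
    intro z
    have : z.1 = (Real.sin θ ^ 2 + Real.cos θ ^ 2) • z.1 := by
      rw [Real.sin_sq_add_cos_sq, one_smul]
    conv_rhs => rw [this]
    module
  have h1 : ∀ z, a z.1 * fderiv ℝ b (Real.cos θ • z.1 + Real.sin θ • z.2)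
        (-Real.sin θ • z.1 + Real.cos θ • z.2) = Φ (ContinuousLinearMap.rotation θ z) := by
    intro z
    simp only [Φ, ContinuousLinearMap.rotation_apply, hbase]
  have h2 : ∀ z, ∑ i, fderiv ℝ a z.1 (e i) *
        fderiv ℝ b (Real.cos θ • z.1 + Real.sin θ • z.2) (e i) =
        Ψ (ContinuousLinearMap.rotation θ z) := by
    intro z
    simp only [Ψ, ContinuousLinearMap.rotation_apply, hbase]
  have hcomp : ∀ k : EuclideanSpace ℝ (Fin n) × EuclideanSpace ℝ (Fin n) → ℝ, Continuous k →
      ∫ z, k (ContinuousLinearMap.rotation θ z) ∂(stdGaussian n).prod (stdGaussian n) =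
        ∫ z, k z ∂(stdGaussian n).prod (stdGaussian n) := by
    intro k hk
    conv_rhs => rw [← hrot.map_eq]
    rw [integral_map hrot.measurable.aemeasurable hk.aestronglyMeasurable]
  have hΦi : Integrable Φ ((stdGaussian n).prod (stdGaussian n)) := by
    refine integrable_of_abs_le_sq_growth (C := 2 * C * B) hΦc.aestronglyMeasurable fun z => ?_
    have i1 := hC (Real.cos θ • z.1 - Real.sin θ • z.2)
    have i2 := (fderiv ℝ b z.1).le_of_opNorm_le (hnB z.1) z.2
    rw [Real.norm_eq_abs] at i2
    have i3 := hcs z.1 z.2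
    have i4 := norm_fst_le z
    have i5 := norm_snd_le z
    have i6 : |a (Real.cos θ • z.1 - Real.sin θ • z.2)| ≤ C * (2 * (1 + ‖z‖)) :=
      i1.trans (mul_le_mul_of_nonneg_left (by linarith) hC0)
    have i7 : |fderiv ℝ b z.1 z.2| ≤ B * (1 + ‖z‖) :=
      i2.trans (mul_le_mul_of_nonneg_left (by linarith) B.2)
    simp only [Φ, abs_mul]
    calc _ ≤ (C * (2 * (1 + ‖z‖))) * (B * (1 + ‖z‖)) :=
          mul_le_mul i6 i7 (abs_nonneg _) (by positivity)
      _ = _ := by ring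
  have hΨi : Integrable Ψ ((stdGaussian n).prod (stdGaussian n)) := by
    refine integrable_of_abs_le_sq_growth (C := n * (A * B)) hΨc.aestronglyMeasurable fun z => ?_
    have j1 : ∀ i, |fderiv ℝ a (Real.cos θ • z.1 - Real.sin θ • z.2) (e i) *
        fderiv ℝ b z.1 (e i)| ≤ A * B := by
      intro i
      have k1 := (fderiv ℝ a (Real.cos θ • z.1 - Real.sin θ • z.2)).le_of_opNorm_le (hnA _) (e i)
      have k2 := (fderiv ℝ b z.1).le_of_opNorm_le (hnB _) (e i)
      simp only [he, PiLp.norm_single, norm_one, mul_one, Real.norm_eq_abs] at k1 k2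
      rw [abs_mul]
      exact mul_le_mul k1 k2 (abs_nonneg _) A.2
    have j2 : |Ψ z| ≤ n * (A * B) := by
      refine (Finset.abs_sum_le_sum_abs _ _).trans ?_
      refine (Finset.sum_le_sum fun i _ => j1 i).trans ?_
      simp
    refine j2.trans (le_mul_of_one_le_right (by positivity) ?_)
    nlinarith [norm_nonneg z]
  rw [integral_congr_ae (Filter.Eventually.of_forall h1),
    integral_congr_ae (Filter.Eventually.of_forall h2), hcomp Φ hΦc, hcomp Ψ hΨc,
    integral_prod _ hΦi, integral_prod _ hΨi, ← integral_const_mul]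
  refine integral_congr_ae (Filter.Eventually.of_forall fun w => ?_)
  simp only
  set u := (InnerProductSpace.toDual ℝ _).symm (fderiv ℝ b w) with hu
  set h : EuclideanSpace ℝ (Fin n) → ℝ := fun v => a (Real.cos θ • w - Real.sin θ • v) with hh
  have hhc : ContDiff ℝ 1 h := ha.comp (by fun_prop)
  have hhd : ∀ v y, fderiv ℝ h v y =
      -Real.sin θ * fderiv ℝ a (Real.cos θ • w - Real.sin θ • v) y := by
    intro v y
    have d1 : HasFDerivAt (fun v : EuclideanSpace ℝ (Fin n) => Real.cos θ • w - Real.sin θ • v)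
        (-(Real.sin θ • ContinuousLinearMap.id ℝ _)) v :=
      ((hasFDerivAt_id v).const_smul (Real.sin θ)).const_sub _
    have d2 := ((ha.differentiable (by norm_num)) (Real.cos θ • w - Real.sin θ • v)).hasFDerivAt.comp
      v d1
    have d3 : fderiv ℝ h v = _ := d2.fderiv
    rw [d3]
    simp
  have hfu : ∀ y, fderiv ℝ b w y = ⟪u, y⟫ := fun y => by
    rw [hu, InnerProductSpace.toDual_symm_apply]
  have hgrow : ∀ v, |h v| ≤ C * (1 + ‖w‖) * (1 + ‖v‖) := by
    intro v
    refine (hC _).trans ?_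
    rw [mul_assoc]
    refine mul_le_mul_of_nonneg_left ?_ hC0
    nlinarith [hcs w v, norm_nonneg w, norm_nonneg v, mul_nonneg (norm_nonneg w) (norm_nonneg v)]
  have hst := integral_inner_mul_stdGaussian (hhc.differentiable (by norm_num))
    (integrable_of_abs_le_sq_growth (C := C * (1 + ‖w‖)) hhc.continuous.aestronglyMeasurable
      fun v => (hgrow v).trans (mul_le_mul_of_nonneg_left
        (by nlinarith [norm_nonneg v]) (by positivity))) u
    (integrable_of_abs_le_sq_growth (C := C * (1 + ‖w‖) * ‖u‖)
      (hhc.continuous.mul (by fun_prop)).aestronglyMeasurable fun v => by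
        rw [abs_mul]
        calc _ ≤ (C * (1 + ‖w‖) * (1 + ‖v‖)) * (‖u‖ * (1 + ‖v‖)) :=
              mul_le_mul (hgrow v) ((abs_real_inner_le_norm u v).trans
                (mul_le_mul_of_nonneg_left (by linarith) (norm_nonneg u)))
                (abs_nonneg _) (by positivity)
          _ = _ := by ring)
    (integrable_of_abs_le_sq_growth (C := A * ‖u‖)
      ((hhc.continuous_fderiv (by norm_num)).clm_apply continuous_const).aestronglyMeasurable
      fun v => by
        rw [hhd, abs_mul, abs_neg]
        have k1 := (fderiv ℝ a (Real.cos θ • w - Real.sin θ • v)).le_of_opNorm_le (hnA _) u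
        rw [Real.norm_eq_abs] at k1
        calc _ ≤ 1 * (A * ‖u‖) := mul_le_mul (Real.abs_sin_le_one θ) k1 (abs_nonneg _) (by norm_num)
          _ = (A * ‖u‖) * 1 := by ring
          _ ≤ _ := mul_le_mul_of_nonneg_left (by nlinarith [norm_nonneg v]) (by positivity))
  simp only [Φ, Ψ, hfu]
  rw [hst, ← integral_const_mul]
  refine integral_congr_ae (Filter.Eventually.of_forall fun v => ?_)
  simp only [hhd]
  rw [hu, apply_toDual_symm_eq_sum]
  simp only [← hu, ← hfu, he]

/-- The derivative of the Gaussian correlation along the rotation semigroup. -/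
lemma hasDerivAt_integral_mul_rotation {n : ℕ} {a b : EuclideanSpace ℝ (Fin n) → ℝ}
    (ha : ContDiff ℝ 1 a) (hb : ContDiff ℝ 1 b) {A B : NNReal}
    (hA : LipschitzWith A a) (hB : LipschitzWith B b) (θ : ℝ) :
    HasDerivAt (fun θ : ℝ => ∫ z, a z.1 * b (Real.cos θ • z.1 + Real.sin θ • z.2)
        ∂(stdGaussian n).prod (stdGaussian n))
      (-Real.sin θ * ∫ z, ∑ i, fderiv ℝ a z.1 (EuclideanSpace.single i 1) *
        fderiv ℝ b (Real.cos θ • z.1 + Real.sin θ • z.2) (EuclideanSpace.single i 1)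
        ∂(stdGaussian n).prod (stdGaussian n)) θ := by
  rw [← integral_mul_fderiv_rotation ha hb hA hB θ]
  have hca : Continuous a := ha.continuous
  have hcb : Continuous b := hb.continuous
  have hdb : Continuous (fderiv ℝ b) := hb.continuous_fderiv (by norm_num)
  have hnB : ∀ x, ‖fderiv ℝ b x‖ ≤ B := fun x => norm_fderiv_le_of_lipschitz ℝ hB
  obtain ⟨C, hC0, hC⟩ := hA.exists_abs_le_growth
  obtain ⟨D, hD0, hD⟩ := hB.exists_abs_le_growth
  have hsm : ∀ s t : ℝ, |s| ≤ 1 → |t| ≤ 1 →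
      ∀ z : EuclideanSpace ℝ (Fin n) × EuclideanSpace ℝ (Fin n),
      ‖s • z.1 + t • z.2‖ ≤ 2 * ‖z‖ := by
    intro s t hs ht z
    have i1 : ‖s • z.1‖ ≤ ‖z‖ := by
      rw [norm_smul]
      exact (mul_le_of_le_one_left (norm_nonneg _) hs).trans (norm_fst_le z)
    have i2 : ‖t • z.2‖ ≤ ‖z‖ := by
      rw [norm_smul]
      exact (mul_le_of_le_one_left (norm_nonneg _) ht).trans (norm_snd_le z)
    linarith [norm_add_le (s • z.1) (t • z.2)]
  have hCz : ∀ z : EuclideanSpace ℝ (Fin n) × EuclideanSpace ℝ (Fin n),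
      |a z.1| ≤ C * (1 + ‖z‖) := fun z =>
    (hC z.1).trans (mul_le_mul_of_nonneg_left (by linarith [norm_fst_le z]) hC0)
  have hbd : ∀ (t : ℝ) (z : EuclideanSpace ℝ (Fin n) × EuclideanSpace ℝ (Fin n)),
      ‖a z.1 * fderiv ℝ b (Real.cos t • z.1 + Real.sin t • z.2)
        (-Real.sin t • z.1 + Real.cos t • z.2)‖ ≤ 2 * C * B * (1 + ‖z‖) ^ 2 := by
    intro t z
    have k1 := (fderiv ℝ b (Real.cos t • z.1 + Real.sin t • z.2)).le_of_opNorm_le (hnB _)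
      (-Real.sin t • z.1 + Real.cos t • z.2)
    have k2 := hsm (-Real.sin t) (Real.cos t) (by simpa using Real.abs_sin_le_one t)
      (Real.abs_cos_le_one t) z
    rw [norm_mul]
    calc _ ≤ (C * (1 + ‖z‖)) * (B * (2 * (1 + ‖z‖))) :=
          mul_le_mul (hCz z) (k1.trans (mul_le_mul_of_nonneg_left (by linarith) B.2))
            (norm_nonneg _) (by positivity)
      _ = _ := by ring
  refine (hasDerivAt_integral_of_dominated_loc_of_deriv_le (s := Set.univ)
    (bound := fun z => 2 * C * B * (1 + ‖z‖) ^ 2)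
    (F' := fun t z => a z.1 * fderiv ℝ b (Real.cos t • z.1 + Real.sin t • z.2)
        (-Real.sin t • z.1 + Real.cos t • z.2))
    Filter.univ_mem (Filter.Eventually.of_forall fun t => ?_) ?_ ?_
    (Filter.Eventually.of_forall fun z t _ => hbd t z) ?_
    (Filter.Eventually.of_forall fun z t _ => ?_)).2
  · exact Continuous.aestronglyMeasurable (by fun_prop)
  · refine integrable_of_abs_le_sq_growth (C := 2 * C * D)
      (Continuous.aestronglyMeasurable (by fun_prop)) fun z => ?_
    rw [abs_mul]
    calc _ ≤ (C * (1 + ‖z‖)) * (D * (2 * (1 + ‖z‖))) :=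
          mul_le_mul (hCz z) ((hD _).trans (mul_le_mul_of_nonneg_left (by
            linarith [hsm _ _ (Real.abs_cos_le_one θ) (Real.abs_sin_le_one θ) z]) hD0))
            (abs_nonneg _) (by positivity)
      _ = _ := by ring
  · refine Continuous.aestronglyMeasurable ?_
    exact (hca.comp continuous_fst).mul ((hdb.comp (by fun_prop)).clm_apply (by fun_prop))
  · refine integrable_of_abs_le_sq_growth (C := 2 * C * B)
      (Continuous.aestronglyMeasurable (by fun_prop)) fun z => ?_
    rw [abs_of_nonneg (by positivity)]
  · have d1 : HasDerivAt (fun t : ℝ => Real.cos t • z.1 + Real.sin t • z.2)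
        (-Real.sin t • z.1 + Real.cos t • z.2) t :=
      ((Real.hasDerivAt_cos t).smul_const z.1).add ((Real.hasDerivAt_sin t).smul_const z.2)
    exact (((hb.differentiable (by norm_num) _).hasFDerivAt.comp_hasDerivAt t d1)).const_mul _

lemma ConvexOn.comp_line {V : Type*} [AddCommGroup V] [Module ℝ V] {f : V → ℝ}
    (hc : ConvexOn ℝ Set.univ f) (x v : V) :
    ConvexOn ℝ Set.univ (fun t : ℝ => f (x + t • v)) := by
  refine ⟨convex_univ, fun s _ t _ α β hα hβ hαβ => ?_⟩
  have h := hc.2 (Set.mem_univ (x + s • v)) (Set.mem_univ (x + t • v)) hα hβ hαβ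
  have hx : α • (x + s • v) + β • (x + t • v) = x + (α • s + β • t) • v := by
    have : x = (α + β) • x := by rw [hαβ, one_smul]
    conv_rhs => rw [this]
    simp only [smul_eq_mul]
    module
  rwa [hx] at h

lemma ConvexOn.fderiv_fderiv_nonneg {V : Type*} [NormedAddCommGroup V] [NormedSpace ℝ V]
    {f : V → ℝ} (hc : ConvexOn ℝ Set.univ f) (hf : ContDiff ℝ 2 f) (x v : V) :
    0 ≤ fderiv ℝ (fderiv ℝ f) x v v := by
  have hl : ∀ t : ℝ, HasDerivAt (fun t : ℝ => x + t • v) v t := fun t => by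
    simpa using ((hasDerivAt_id t).smul_const v).const_add x
  have h1 : ∀ t : ℝ, HasDerivAt (fun t : ℝ => f (x + t • v)) (fderiv ℝ f (x + t • v) v) t :=
    fun t => (hf.differentiable (by norm_num) _).hasFDerivAt.comp_hasDerivAt t (hl t)
  have hconv := hc.comp_line x v
  have hmono : Monotone (fun t : ℝ => fderiv ℝ f (x + t • v) v) := by
    have h := hconv.monotoneOn_deriv fun t _ => (h1 t).differentiableAt
    have he : deriv (fun t : ℝ => f (x + t • v)) = fun t : ℝ => fderiv ℝ f (x + t • v) v :=
      funext fun t => (h1 t).deriv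
    rw [he] at h
    exact monotoneOn_univ.mp h
  have hd : Differentiable ℝ (fderiv ℝ f) :=
    (hf.fderiv_right (m := 1) (by norm_num)).differentiable (by norm_num)
  have h2 : HasDerivAt (fun t : ℝ => fderiv ℝ f (x + t • v) v)
      (fderiv ℝ (fderiv ℝ f) x v v) 0 := by
    have h3 : HasDerivAt (fun t : ℝ => fderiv ℝ f (x + t • v))
        (fderiv ℝ (fderiv ℝ f) (x + (0 : ℝ) • v) v) 0 :=
      (hd _).hasFDerivAt.comp_hasDerivAt (0 : ℝ) (hl 0)
    rw [zero_smul, add_zero] at h3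
    simpa using h3.clm_apply (hasDerivAt_const (0 : ℝ) v)
  rw [← h2.deriv]
  exact hmono.deriv_nonneg

lemma ConvexOn.posSemidef_hessian {n : ℕ} {f : EuclideanSpace ℝ (Fin n) → ℝ}
    (hc : ConvexOn ℝ Set.univ f) (hf : ContDiff ℝ 2 f) (x : EuclideanSpace ℝ (Fin n)) :
    (Matrix.of fun i j => fderiv ℝ (fderiv ℝ f) x (EuclideanSpace.single j 1)
      (EuclideanSpace.single i 1)).PosSemidef := by
  refine Matrix.PosSemidef.of_dotProduct_mulVec_nonneg ?_ fun v => ?_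
  · ext i j
    simp only [Matrix.conjTranspose_apply, Matrix.of_apply, star_trivial]
    exact hf.contDiffAt.isSymmSndFDerivAt (by simp) _ _
  · have h := hc.fderiv_fderiv_nonneg hf x (WithLp.toLp 2 v)
    have hv : WithLp.toLp 2 v = ∑ i, v i • EuclideanSpace.single i (1 : ℝ) := by
      ext j
      simp [Finset.sum_apply, Pi.single_apply]
    refine h.trans_eq ?_
    rw [hv]
    simp only [map_sum, map_smul, dotProduct, Matrix.mulVec, star_trivial, Matrix.of_apply,
      sum_apply, smul_apply, smul_eq_mul, Finset.mul_sum]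
    refine Finset.sum_congr rfl fun i _ => Finset.sum_congr rfl fun j _ => ?_
    ring

lemma Matrix.PosSemidef.sum_mul_nonneg {ι : Type*} [Fintype ι] {A B : Matrix ι ι ℝ}
    (hA : A.PosSemidef) (hB : B.PosSemidef) : 0 ≤ ∑ i, ∑ j, A i j * B i j := by
  have h := (hA.hadamard hB).dotProduct_mulVec_nonneg (fun _ => 1)
  simpa [dotProduct, Matrix.mulVec] using h

/-- The covariance inequality with the gradient means expressed through first moments. -/
def GaussianCovarianceIneq {n : ℕ} (f g : EuclideanSpace ℝ (Fin n) → ℝ) : Prop :=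
  (∫ x, f x ∂stdGaussian n) * (∫ x, g x ∂stdGaussian n)
      + ∑ i, (∫ x, f x * x i ∂stdGaussian n) * (∫ x, g x * x i ∂stdGaussian n)
    ≤ ∫ x, f x * g x ∂stdGaussian n

lemma integrable_fderiv_mul_fderiv_rotation {n : ℕ} {a b : EuclideanSpace ℝ (Fin n) → ℝ}
    (ha : ContDiff ℝ 1 a) (hb : ContDiff ℝ 1 b) {A B : NNReal}
    (hA : LipschitzWith A a) (hB : LipschitzWith B b) (θ : ℝ) (u v : EuclideanSpace ℝ (Fin n)) :
    Integrable (fun z : EuclideanSpace ℝ (Fin n) × EuclideanSpace ℝ (Fin n) =>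
      fderiv ℝ a z.1 u * fderiv ℝ b (Real.cos θ • z.1 + Real.sin θ • z.2) v)
      ((stdGaussian n).prod (stdGaussian n)) := by
  refine integrable_of_abs_le_sq_growth (C := (A * ‖u‖) * (B * ‖v‖)) ?_ fun z => ?_
  · refine Continuous.aestronglyMeasurable (Continuous.mul ?_ ?_)
    · exact ((ha.continuous_fderiv (by norm_num)).comp continuous_fst).clm_apply continuous_const
    · exact ((hb.continuous_fderiv (by norm_num)).comp (by fun_prop)).clm_apply continuous_const
  · have k1 := (fderiv ℝ a z.1).le_of_opNorm_le (norm_fderiv_le_of_lipschitz ℝ hA) u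
    have k2 := (fderiv ℝ b (Real.cos θ • z.1 + Real.sin θ • z.2)).le_of_opNorm_le
      (norm_fderiv_le_of_lipschitz ℝ hB) v
    rw [Real.norm_eq_abs] at k1 k2
    rw [abs_mul]
    refine (mul_le_mul k1 k2 (abs_nonneg _) (by positivity)).trans
      (le_mul_of_one_le_right (by positivity) ?_)
    nlinarith [norm_nonneg z]

lemma LipschitzWith.integral_mul_coord_stdGaussian {n : ℕ} {f : EuclideanSpace ℝ (Fin n) → ℝ}
    (hf : ContDiff ℝ 1 f) {K : NNReal} (hK : LipschitzWith K f) (i : Fin n) :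
    ∫ x, f x * x i ∂stdGaussian n =
      ∫ x, fderiv ℝ f x (EuclideanSpace.single i 1) ∂stdGaussian n := by
  obtain ⟨C, hC0, hC⟩ := hK.exists_abs_le_growth
  have hcoord : ∀ x : EuclideanSpace ℝ (Fin n), ⟪EuclideanSpace.single i 1, x⟫ = x i := by
    intro x
    simp [EuclideanSpace.inner_single_left]
  have h := integral_inner_mul_stdGaussian (hf.differentiable (by norm_num))
    (integrable_of_abs_le_sq_growth (C := C) hf.continuous.aestronglyMeasurable fun v =>
      (hC v).trans (mul_le_mul_of_nonneg_left (by nlinarith [norm_nonneg v]) (by positivity)))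
    (EuclideanSpace.single i 1)
    (integrable_of_abs_le_sq_growth (C := C)
      (hf.continuous.mul (by fun_prop)).aestronglyMeasurable fun v => by
        rw [abs_mul]
        calc _ ≤ (C * (1 + ‖v‖)) * (1 + ‖v‖) := by
              refine mul_le_mul (hC v) ?_ (abs_nonneg _) (by positivity)
              refine (abs_real_inner_le_norm _ v).trans ?_
              simp
          _ = _ := by ring)
    (integrable_of_abs_le_sq_growth (C := K)
      ((hf.continuous_fderiv (by norm_num)).clm_apply continuous_const).aestronglyMeasurable
      fun v => by
        have k1 := (fderiv ℝ f v).le_of_opNorm_le (norm_fderiv_le_of_lipschitz ℝ hK)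
          (EuclideanSpace.single i 1)
        simp only [PiLp.norm_single, norm_one, mul_one, Real.norm_eq_abs] at k1
        exact k1.trans (le_mul_of_one_le_right K.2 (by nlinarith [norm_nonneg v])))
  simpa only [hcoord] using h

lemma gaussianCovarianceIneq_of_contDiff {n : ℕ} {f g : EuclideanSpace ℝ (Fin n) → ℝ}
    (hfc : ConvexOn ℝ Set.univ f) (hgc : ConvexOn ℝ Set.univ g)
    (hf : ContDiff ℝ 2 f) (hg : ContDiff ℝ 2 g) {A B A' B' : NNReal}
    (hA : LipschitzWith A f) (hB : LipschitzWith B g)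
    (hA' : LipschitzWith A' (fderiv ℝ f)) (hB' : LipschitzWith B' (fderiv ℝ g)) :
    GaussianCovarianceIneq f g := by
  have hf1 : ContDiff ℝ 1 f := hf.of_le (by norm_num)
  have hg1 : ContDiff ℝ 1 g := hg.of_le (by norm_num)
  set e : Fin n → EuclideanSpace ℝ (Fin n) := fun i => EuclideanSpace.single i 1 with he
  have hpart : ∀ {h : EuclideanSpace ℝ (Fin n) → ℝ} {H : NNReal}, ContDiff ℝ 2 h →
      LipschitzWith H (fderiv ℝ h) → ∀ i, ContDiff ℝ 1 (fun x => fderiv ℝ h x (e i)) ∧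
        LipschitzWith H (fun x => fderiv ℝ h x (e i)) ∧
        ∀ x v, fderiv ℝ (fun x => fderiv ℝ h x (e i)) x v =
          fderiv ℝ (fderiv ℝ h) x v (e i) := by
    intro h H hh hH i
    have hd : ContDiff ℝ 1 (fderiv ℝ h) := hh.fderiv_right (m := 1) (by norm_num)
    refine ⟨hd.clm_apply contDiff_const, ?_, fun x v => ?_⟩
    · refine LipschitzWith.of_dist_le_mul fun x y => ?_
      rw [dist_eq_norm, ← sub_apply]
      refine ((fderiv ℝ h x - fderiv ℝ h y).le_opNorm (e i)).trans ?_
      simp only [he, PiLp.norm_single, norm_one, mul_one, ← dist_eq_norm]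
      exact hH.dist_le_mul x y
    · rw [fderiv_clm_apply (hd.differentiable (by norm_num) x) (differentiableAt_const _)]
      simp
  set G : ℝ → ℝ := fun θ => ∫ z, f z.1 * g (Real.cos θ • z.1 + Real.sin θ • z.2)
    ∂(stdGaussian n).prod (stdGaussian n) with hG
  set K : ℝ → ℝ := fun θ => ∑ i, ∫ z, fderiv ℝ f z.1 (e i) *
    fderiv ℝ g (Real.cos θ • z.1 + Real.sin θ • z.2) (e i)
    ∂(stdGaussian n).prod (stdGaussian n) with hK
  have hGd : ∀ θ, HasDerivAt G (-Real.sin θ * K θ) θ := by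
    intro θ
    have h := hasDerivAt_integral_mul_rotation hf1 hg1 hA hB θ
    rw [integral_finsetSum _ fun i _ =>
      integrable_fderiv_mul_fderiv_rotation hf1 hg1 hA hB θ _ _] at h
    exact h
  have hKd : ∀ θ, ∃ d, 0 ≤ d ∧ HasDerivAt K (-Real.sin θ * d) θ := by
    intro θ
    have h := HasDerivAt.fun_sum (u := Finset.univ) fun i _ => hasDerivAt_integral_mul_rotation
      (hpart hf hA' i).1 (hpart hg hB' i).1 (hpart hf hA' i).2.1 (hpart hg hB' i).2.1 θ
    rw [← Finset.mul_sum] at h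
    refine ⟨_, ?_, h⟩
    · rw [← integral_finsetSum _ fun i _ => integrable_finsetSum _ fun j _ =>
        integrable_fderiv_mul_fderiv_rotation (hpart hf hA' i).1 (hpart hg hB' i).1
          (hpart hf hA' i).2.1 (hpart hg hB' i).2.1 θ _ _]
      refine integral_nonneg fun z => ?_
      simp only [(hpart hf hA' _).2.2, (hpart hg hB' _).2.2]
      exact (hfc.posSemidef_hessian hf _).sum_mul_nonneg (hgc.posSemidef_hessian hg _)
  have hsin : ∀ θ ∈ Set.Icc 0 (Real.pi / 2), 0 ≤ Real.sin θ := fun θ hθ =>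
    Real.sin_nonneg_of_nonneg_of_le_pi hθ.1 (by linarith [hθ.2, Real.pi_pos])
  have hpi : (0 : ℝ) ≤ Real.pi / 2 := by positivity
  have hKanti : AntitoneOn K (Set.Icc 0 (Real.pi / 2)) := by
    refine antitoneOn_of_deriv_nonpos (convex_Icc _ _)
      (fun θ _ => ?_) (fun θ _ => ?_) fun θ hθ => ?_
    · obtain ⟨d, -, hd⟩ := hKd θ
      exact hd.continuousAt.continuousWithinAt
    · obtain ⟨d, -, hd⟩ := hKd θ
      exact hd.differentiableAt.differentiableWithinAt
    · obtain ⟨d, hd0, hd⟩ := hKd θ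
      rw [hd.deriv]
      nlinarith [mul_nonneg (hsin θ (interior_subset hθ)) hd0]
  have hNd : ∀ θ, HasDerivAt (fun θ => G θ - K (Real.pi / 2) * Real.cos θ)
      (-Real.sin θ * K θ - K (Real.pi / 2) * -Real.sin θ) θ := fun θ =>
    (hGd θ).sub ((Real.hasDerivAt_cos θ).const_mul _)
  have hNanti : AntitoneOn (fun θ => G θ - K (Real.pi / 2) * Real.cos θ)
      (Set.Icc 0 (Real.pi / 2)) := by
    refine antitoneOn_of_deriv_nonpos (convex_Icc _ _)
      (fun θ _ => (hNd θ).continuousAt.continuousWithinAt)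
      (fun θ _ => (hNd θ).differentiableAt.differentiableWithinAt) fun θ hθ => ?_
    rw [(hNd θ).deriv]
    have hθ' := interior_subset hθ
    nlinarith [mul_nonneg (hsin θ hθ') (sub_nonneg.2 (hKanti hθ' (Set.right_mem_Icc.2 hpi) hθ'.2))]
  have hfin := hNanti (Set.left_mem_Icc.2 hpi) (Set.right_mem_Icc.2 hpi) hpi
  have hG0 : G 0 = ∫ x, f x * g x ∂stdGaussian n := by
    simp only [hG, Real.cos_zero, Real.sin_zero, one_smul, zero_smul, add_zero]
    have := integral_fun_fst (μ := stdGaussian n) (ν := stdGaussian n) (fun x => f x * g x)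
    simpa using this
  have hG1 : G (Real.pi / 2) = (∫ x, f x ∂stdGaussian n) * (∫ x, g x ∂stdGaussian n) := by
    simp only [hG, Real.cos_pi_div_two, Real.sin_pi_div_two, one_smul, zero_smul, zero_add]
    exact integral_prod_mul f g
  have hK1 : K (Real.pi / 2) =
      ∑ i, (∫ x, f x * x i ∂stdGaussian n) * (∫ x, g x * x i ∂stdGaussian n) := by
    simp only [hK, Real.cos_pi_div_two, Real.sin_pi_div_two, one_smul, zero_smul, zero_add]
    refine Finset.sum_congr rfl fun i _ => ?_
    rw [hA.integral_mul_coord_stdGaussian hf1 i, hB.integral_mul_coord_stdGaussian hg1 i]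
    exact integral_prod_mul (fun x => fderiv ℝ f x (e i)) (fun x => fderiv ℝ g x (e i))
  simp only [Real.cos_pi_div_two, Real.cos_zero] at hfin
  rw [GaussianCovarianceIneq, ← hG0, ← hG1, ← hK1]
  linarith

/-- Dominated convergence for the covariance inequality. -/
lemma GaussianCovarianceIneq.of_tendsto {n : ℕ} {P Q : ENNReal} [ENNReal.HolderTriple P Q 1]
    (hP : P ≠ ⊤) (hQ : Q ≠ ⊤) {f g F G : EuclideanSpace ℝ (Fin n) → ℝ}
    {u v : ℕ → EuclideanSpace ℝ (Fin n) → ℝ} (h : ∀ k, GaussianCovarianceIneq (u k) (v k))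
    (hu : ∀ k, Continuous (u k)) (hv : ∀ k, Continuous (v k))
    (huF : ∀ k x, |u k x| ≤ F x) (hvG : ∀ k x, |v k x| ≤ G x)
    (hF : MemLp F P (stdGaussian n)) (hG : MemLp G Q (stdGaussian n))
    (huf : ∀ x, Filter.Tendsto (fun k => u k x) Filter.atTop (nhds (f x)))
    (hvg : ∀ x, Filter.Tendsto (fun k => v k x) Filter.atTop (nhds (g x))) :
    GaussianCovarianceIneq f g := by
  have hQP : ENNReal.HolderTriple Q P 1 := ENNReal.HolderTriple.symm
  have hP1 : 1 ≤ P := ENNReal.HolderTriple.le P Q 1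
  have hQ1 : 1 ≤ Q := ENNReal.HolderTriple.le Q P 1
  have hcoord : ∀ i, Continuous fun x : EuclideanSpace ℝ (Fin n) => x i := fun i => by fun_prop
  refine le_of_tendsto_of_tendsto' (b := Filter.atTop) (Filter.Tendsto.add (Filter.Tendsto.mul ?_ ?_)
    (tendsto_finsetSum _ fun i _ => Filter.Tendsto.mul ?_ ?_)) ?_ h
  · exact tendsto_integral_of_dominated_convergence F (fun k => (hu k).aestronglyMeasurable)
      (hF.integrable hP1) (fun k => .of_forall (huF k)) (.of_forall huf)
  · exact tendsto_integral_of_dominated_convergence G (fun k => (hv k).aestronglyMeasurable)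
      (hG.integrable hQ1) (fun k => .of_forall (hvG k)) (.of_forall hvg)
  · refine tendsto_integral_of_dominated_convergence (fun x => F x * ‖x‖)
      (fun k => ((hu k).mul (hcoord i)).aestronglyMeasurable)
      (hF.integrable_mul (memLp_norm_stdGaussian n hQ)) (fun k => .of_forall fun x => ?_)
      (.of_forall fun x => (huf x).mul_const _)
    rw [norm_mul]
    exact mul_le_mul (huF k x) (PiLp.norm_apply_le x i) (norm_nonneg _)
      ((abs_nonneg _).trans (huF k x))
  · refine tendsto_integral_of_dominated_convergence (fun x => G x * ‖x‖)
      (fun k => ((hv k).mul (hcoord i)).aestronglyMeasurable)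
      (hG.integrable_mul (memLp_norm_stdGaussian n hP)) (fun k => .of_forall fun x => ?_)
      (.of_forall fun x => (hvg x).mul_const _)
    rw [norm_mul]
    exact mul_le_mul (hvG k x) (PiLp.norm_apply_le x i) (norm_nonneg _)
      ((abs_nonneg _).trans (hvG k x))
  · refine tendsto_integral_of_dominated_convergence (fun x => F x * G x)
      (fun k => ((hu k).mul (hv k)).aestronglyMeasurable)
      (hF.integrable_mul hG) (fun k => .of_forall fun x => ?_)
      (.of_forall fun x => (huf x).mul (hvg x))
    rw [norm_mul]
    exact mul_le_mul (huF k x) (hvG k x) (norm_nonneg _) ((abs_nonneg _).trans (huF k x))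

/-- Convolution with a compactly supported kernel preserves Lipschitz continuity. -/
lemma LipschitzWith.convolution_left {V E' F' : Type*} [NormedAddCommGroup V] [MeasurableSpace V]
    [BorelSpace V] [NormedAddCommGroup E'] [NormedSpace ℝ E']
    [NormedAddCommGroup F'] [NormedSpace ℝ F'] {ν : Measure V} [IsFiniteMeasureOnCompacts ν]
    (L : E' →L[ℝ] ℝ →L[ℝ] F') {ψ : V → E'} (hψ : Continuous ψ) (hc : HasCompactSupport ψ)
    {f : V → ℝ} {K : NNReal} (hf : LipschitzWith K f) :
    LipschitzWith (Real.toNNReal (‖L‖ * K * ∫ t, ‖ψ t‖ ∂ν)) (convolution ψ f L ν) := by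
  have hψi : Integrable (fun t => ‖ψ t‖) ν := (hψ.integrable_of_hasCompactSupport hc).norm
  have hex : ConvolutionExists ψ f L ν :=
    hc.convolutionExists_left_of_continuous_right L
      (hψ.integrable_of_hasCompactSupport hc).locallyIntegrable hf.continuous
  refine LipschitzWith.of_dist_le_mul fun x y => ?_
  rw [Real.coe_toNNReal _ (by positivity), dist_eq_norm, convolution_def, convolution_def,
    ← integral_sub (hex x) (hex y)]
  calc ‖∫ t, (L (ψ t) (f (x - t)) - L (ψ t) (f (y - t))) ∂ν‖
      ≤ ∫ t, ‖L‖ * K * dist x y * ‖ψ t‖ ∂ν := by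
        refine norm_integral_le_of_norm_le (hψi.const_mul _) (.of_forall fun t => ?_)
        rw [← map_sub]
        have h1 := hf.dist_le_mul (x - t) (y - t)
        rw [dist_sub_right, dist_eq_norm] at h1
        calc _ ≤ ‖L‖ * ‖ψ t‖ * ‖f (x - t) - f (y - t)‖ := L.le_opNorm₂ _ _
          _ ≤ ‖L‖ * ‖ψ t‖ * (K * dist x y) := by gcongr
          _ = _ := by ring
    _ = _ := by rw [integral_const_mul]; ring

/-- A Lipschitz convex function is a uniform limit of smooth convex functions which are Lipschitz
together with their derivatives. -/
lemma ConvexOn.exists_contDiff_approx {V : Type*} [NormedAddCommGroup V] [InnerProductSpace ℝ V]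
    [FiniteDimensional ℝ V] {f : V → ℝ} (hfc : ConvexOn ℝ Set.univ f) {K : NNReal}
    (hf : LipschitzWith K f) {ε : ℝ} (hε : 0 < ε) :
    ∃ h : V → ℝ, ContDiff ℝ 2 h ∧ ConvexOn ℝ Set.univ h ∧ (∃ A, LipschitzWith A h) ∧
      (∃ A, LipschitzWith A (fderiv ℝ h)) ∧ ∀ x, |h x - f x| ≤ ε := by
  borelize V
  let ν : Measure V := volume
  have hr : 0 < ε / (K + 1) := by positivity
  let φ : ContDiffBump (0 : V) := ⟨ε / (K + 1) / 2, ε / (K + 1), by positivity, by linarith⟩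
  have hφd : ContDiff ℝ 2 (φ.normed ν) := φ.contDiff_normed
  have hφc : HasCompactSupport (φ.normed ν) := φ.hasCompactSupport_normed
  have hfl : LocallyIntegrable f ν := hf.continuous.locallyIntegrable
  have hex : ConvolutionExists (φ.normed ν) f (ContinuousLinearMap.lsmul ℝ ℝ) ν :=
    hφc.convolutionExists_left_of_continuous_right _
      (hφd.continuous.integrable_of_hasCompactSupport hφc).locallyIntegrable hf.continuous
  refine ⟨convolution (φ.normed ν) f (ContinuousLinearMap.lsmul ℝ ℝ) ν,
    hφc.contDiff_convolution_left _ hφd hfl, ⟨convex_univ, fun x _ y _ a b ha hb hab => ?_⟩,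
    ⟨_, hf.convolution_left _ hφd.continuous hφc⟩, ?_, fun x => ?_⟩
  · simp only [convolution_def, smul_eq_mul]
    rw [← integral_const_mul, ← integral_const_mul,
      ← integral_add ((hex x).const_mul a) ((hex y).const_mul b)]
    refine integral_mono (hex _) (((hex x).const_mul a).add ((hex y).const_mul b)) fun t => ?_
    have h1 := hfc.2 (Set.mem_univ (x - t)) (Set.mem_univ (y - t)) ha hb hab
    have h2 : a • x + b • y - t = a • (x - t) + b • (y - t) := by
      rw [smul_sub, smul_sub, sub_add_sub_comm, ← add_smul, hab, one_smul]
    simp only [ContinuousLinearMap.lsmul_apply, smul_eq_mul, h2] at h1 ⊢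
    have := mul_le_mul_of_nonneg_left h1 (φ.nonneg_normed (μ := ν) t)
    linarith
  · have hfd : fderiv ℝ (convolution (φ.normed ν) f (ContinuousLinearMap.lsmul ℝ ℝ) ν) =
        convolution (fderiv ℝ (φ.normed ν)) f
          ((ContinuousLinearMap.lsmul ℝ ℝ).precompL V) ν := by
      ext1 x
      exact (hφc.hasFDerivAt_convolution_left _ (hφd.of_le (by norm_num)) hfl x).fderiv
    rw [hfd]
    exact ⟨_, hf.convolution_left _ (hφd.continuous_fderiv (by norm_num)) (hφc.fderiv ℝ)⟩
  · rw [← Real.dist_eq]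
    refine φ.dist_normed_convolution_le hf.continuous.aestronglyMeasurable fun y hy => ?_
    have h1 := hf.dist_le_mul y x
    have h2 : dist y x ≤ ε / (K + 1) := (Metric.mem_ball.1 hy).le
    have h3 : (K : ℝ) * (ε / (K + 1)) ≤ ε := by
      rw [mul_div_assoc', div_le_iff₀ (by positivity)]
      nlinarith
    exact h1.trans ((mul_le_mul_of_nonneg_left h2 K.2).trans h3)

lemma LipschitzWith.memLp_stdGaussian {n : ℕ} {f : EuclideanSpace ℝ (Fin n) → ℝ} {K : NNReal}
    (hf : LipschitzWith K f) {P : ENNReal} (hP : P ≠ ⊤) : MemLp f P (stdGaussian n) := by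
  obtain ⟨C, hC0, hC⟩ := hf.exists_abs_le_growth
  refine ((((memLp_const (1 : ℝ)).add (memLp_norm_stdGaussian n hP)).const_mul C)).mono
    hf.continuous.aestronglyMeasurable (.of_forall fun x => (hC x).trans (le_abs_self _))

lemma gaussianCovarianceIneq_of_lipschitzWith {n : ℕ} {f g : EuclideanSpace ℝ (Fin n) → ℝ}
    (hfc : ConvexOn ℝ Set.univ f) (hgc : ConvexOn ℝ Set.univ g) {A B : NNReal}
    (hf : LipschitzWith A f) (hg : LipschitzWith B g) : GaussianCovarianceIneq f g := by
  have hε : ∀ k : ℕ, (0 : ℝ) < 1 / ((k : ℝ) + 1) := fun k => by positivity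
  have hε1 : ∀ k : ℕ, 1 / ((k : ℝ) + 1) ≤ 1 := fun k => by
    rw [div_le_one (by positivity)]
    linarith [k.cast_nonneg (α := ℝ)]
  choose u hu huc hu1 hu2 huf using fun k : ℕ => hfc.exists_contDiff_approx hf (hε k)
  choose v hv hvc hv1 hv2 hvg using fun k : ℕ => hgc.exists_contDiff_approx hg (hε k)
  have hlim : ∀ {w : ℕ → EuclideanSpace ℝ (Fin n) → ℝ} {h : EuclideanSpace ℝ (Fin n) → ℝ},
      (∀ k x, |w k x - h x| ≤ 1 / ((k : ℝ) + 1)) →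
      ∀ x, Filter.Tendsto (fun k => w k x) Filter.atTop (nhds (h x)) := fun hw x =>
    tendsto_iff_dist_tendsto_zero.2 (squeeze_zero (fun _ => dist_nonneg) (fun k => hw k x)
      tendsto_one_div_add_atTop_nhds_zero_nat)
  have hbd : ∀ {w : ℕ → EuclideanSpace ℝ (Fin n) → ℝ} {h : EuclideanSpace ℝ (Fin n) → ℝ},
      (∀ k x, |w k x - h x| ≤ 1 / ((k : ℝ) + 1)) → ∀ k x, |w k x| ≤ 1 + |h x| := fun hw k x => by
    have := abs_sub_abs_le_abs_sub (_ : ℝ) (_ : ℝ) |>.trans ((hw k x).trans (hε1 k))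
    linarith
  refine GaussianCovarianceIneq.of_tendsto (P := 2) (Q := 2) (by simp) (by simp) (fun k => ?_)
    (fun k => (hu k).continuous) (fun k => (hv k).continuous) (hbd huf) (hbd hvg)
    ((memLp_const (1 : ℝ)).add (hf.memLp_stdGaussian (by simp)).norm)
    ((memLp_const (1 : ℝ)).add (hg.memLp_stdGaussian (by simp)).norm) (hlim huf) (hlim hvg)
  obtain ⟨_, h1⟩ := hu1 k
  obtain ⟨_, h2⟩ := hu2 k
  obtain ⟨_, h3⟩ := hv1 k
  obtain ⟨_, h4⟩ := hv2 k
  exact gaussianCovarianceIneq_of_contDiff (huc k) (hvc k) (hu k) (hv k) h1 h3 h2 h4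

/-- A continuous convex function is an increasing limit of Lipschitz convex functions. -/
lemma ConvexOn.exists_lipschitz_approx {n : ℕ} {f : EuclideanSpace ℝ (Fin n) → ℝ}
    (hfc : ConvexOn ℝ Set.univ f) (hf : Continuous f) :
    ∃ u : ℕ → EuclideanSpace ℝ (Fin n) → ℝ, (∀ k, ConvexOn ℝ Set.univ (u k)) ∧
      (∀ k, ∃ A, LipschitzWith A (u k)) ∧ (∀ k x, |u k x| ≤ |u 0 x| + |f x|) ∧
      ∀ x, Filter.Tendsto (fun k => u k x) Filter.atTop (nhds (f x)) := by
  obtain ⟨l, c, hle, hsup⟩ := hfc.real_univ_sSup_of_nat_affine_eq hf.lowerSemicontinuous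
  have hle' : ∀ i x, l i x + c i ≤ f x := fun i x => hle i x
  have hbdd : ∀ x, BddAbove (Set.range fun i => l i x + c i) := fun x =>
    ⟨f x, by rintro _ ⟨i, rfl⟩; exact hle' i x⟩
  have hsup' : ∀ x, ⨆ i, (l i x + c i) = f x := fun x => by
    have := congrFun hsup x
    rwa [iSup_apply] at this
  let a : ℕ → EuclideanSpace ℝ (Fin n) → ℝ := fun i x => l i x + c i
  have happ : ∀ k x, partialSups a k x = partialSups (fun i => a i x) k := fun k x =>
    Pi.partialSups_apply a k x
  have hub : ∀ k x, partialSups a k x ≤ f x := fun k x => by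
    rw [happ]
    exact partialSups_le _ _ _ fun i _ => hle' i x
  refine ⟨fun k => partialSups a k, fun k => ?_, fun k => ?_, fun k x => ?_, fun x => ?_⟩
  · induction k with
    | zero =>
      simp only [partialSups_zero]
      exact ((l 0).toLinearMap.convexOn convex_univ).add_const (c 0)
    | succ k ih =>
      simp only [partialSups_add_one]
      exact ih.sup (((l (k + 1)).toLinearMap.convexOn convex_univ).add_const (c (k + 1)))
  · have ha : ∀ i, LipschitzWith (‖l i‖₊ + 0) (a i) := fun i =>
      (l i).lipschitz.add (LipschitzWith.const (c i))
    induction k with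
    | zero => exact ⟨_, by simpa using ha 0⟩
    | succ k ih =>
      obtain ⟨A, hA⟩ := ih
      simp only [partialSups_add_one]
      exact ⟨_, hA.max (ha (k + 1))⟩
  · have h1 : partialSups a 0 x ≤ partialSups a k x := (partialSups a).monotone k.zero_le x
    have h2 := hub k x
    rw [abs_le]
    constructor
    · linarith [neg_abs_le (partialSups a 0 x), abs_nonneg (f x)]
    · linarith [le_abs_self (f x), abs_nonneg (partialSups a 0 x)]
  · have h1 := tendsto_atTop_ciSup (f := fun k => partialSups a k x)
      (fun i j hij => (partialSups a).monotone hij x) ⟨f x, by rintro _ ⟨k, rfl⟩; exact hub k x⟩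
    have h2 : ⨆ k, partialSups a k x = f x := by
      simp only [happ]
      rw [ciSup_partialSups_eq (hbdd x), hsup']
    rwa [h2] at h1

lemma gaussianCovarianceIneq_of_memLp {n : ℕ} {P Q : ENNReal} [ENNReal.HolderTriple P Q 1]
    (hP : P ≠ ⊤) (hQ : Q ≠ ⊤) {f g : EuclideanSpace ℝ (Fin n) → ℝ}
    (hfc : ConvexOn ℝ Set.univ f) (hgc : ConvexOn ℝ Set.univ g)
    (hf : MemLp f P (stdGaussian n)) (hg : MemLp g Q (stdGaussian n)) :
    GaussianCovarianceIneq f g := by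
  obtain ⟨u, huc, hul, hub, hut⟩ := hfc.exists_lipschitz_approx hfc.locallyLipschitz.continuous
  obtain ⟨v, hvc, hvl, hvb, hvt⟩ := hgc.exists_lipschitz_approx hgc.locallyLipschitz.continuous
  choose A hA using hul
  choose B hB using hvl
  exact GaussianCovarianceIneq.of_tendsto hP hQ
    (fun k => gaussianCovarianceIneq_of_lipschitzWith (huc k) (hvc k) (hA k) (hB k))
    (fun k => (hA k).continuous) (fun k => (hB k).continuous) hub hvb
    (((hA 0).memLp_stdGaussian hP).norm.add hf.norm)
    (((hB 0).memLp_stdGaussian hQ).norm.add hg.norm) hut hvt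

lemma ConvexOn.add_fderiv_le {V : Type*} [NormedAddCommGroup V] [NormedSpace ℝ V] {f : V → ℝ}
    (hc : ConvexOn ℝ Set.univ f) {x : V} (hd : DifferentiableAt ℝ f x) (v : V) :
    f x + fderiv ℝ f x v ≤ f (x + v) := by
  have hl : HasDerivAt (fun t : ℝ => x + t • v) v 0 := by
    simpa using ((hasDerivAt_id (0 : ℝ)).smul_const v).const_add x
  have h1 : HasDerivAt (fun t : ℝ => f (x + t • v)) (fderiv ℝ f x v) 0 := by
    refine HasFDerivAt.comp_hasDerivAt (0 : ℝ) ?_ hl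
    simpa using hd.hasFDerivAt
  have h2 := (hc.comp_line x v).le_slope_of_hasDerivAt (Set.mem_univ 0) (Set.mem_univ 1)
    one_pos h1
  simp only [slope_def_field, zero_smul, one_smul, add_zero, sub_zero, div_one] at h2
  linarith

/-- A locally Lipschitz function is differentiable almost everywhere. -/
lemma LocallyLipschitz.ae_differentiableAt {V : Type*} [NormedAddCommGroup V] [NormedSpace ℝ V]
    [FiniteDimensional ℝ V] [MeasurableSpace V] [BorelSpace V] {ν : Measure V}
    [ν.IsAddHaarMeasure] {f : V → ℝ} (hf : LocallyLipschitz f) :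
    ∀ᵐ x ∂ν, DifferentiableAt ℝ f x := by
  rw [ae_iff]
  refine measure_null_of_locally_null _ fun x _ => ?_
  obtain ⟨K, t, ht, hK⟩ := hf x
  have h1 := hK.mono (interior_subset (s := t)) |>.ae_differentiableWithinAt_of_mem (μ := ν)
  refine ⟨interior t ∩ {y | ¬ DifferentiableAt ℝ f y}, ?_, ?_⟩
  · exact Filter.inter_mem (mem_nhdsWithin_of_mem_nhds (interior_mem_nhds.2 ht))
      self_mem_nhdsWithin
  · refine measure_mono_null (fun y hy => ?_) (ae_iff.1 h1)
    exact fun h => hy.2 ((h hy.1).differentiableAt (isOpen_interior.mem_nhds hy.1))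

lemma ConvexOn.ae_differentiableAt_stdGaussian {n : ℕ} {f : EuclideanSpace ℝ (Fin n) → ℝ}
    (hc : ConvexOn ℝ Set.univ f) : ∀ᵐ x ∂stdGaussian n, DifferentiableAt ℝ f x :=
  (withDensity_absolutelyContinuous _ _).ae_le
    (hc.locallyLipschitz.ae_differentiableAt (ν := volume))

lemma memLp_exp_inner_stdGaussian {n : ℕ} (a : ℝ) (v : EuclideanSpace ℝ (Fin n)) {Q : ENNReal}
    (hQ : Q ≠ ⊤) : MemLp (fun x => Real.exp (a * ⟪v, x⟫)) Q (stdGaussian n) := by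
  have hm : AEStronglyMeasurable (fun x => Real.exp (a * ⟪v, x⟫)) (stdGaussian n) := by
    refine Continuous.aestronglyMeasurable ?_
    fun_prop
  rcases eq_or_ne Q 0 with rfl | hQ0
  · exact memLp_zero_iff_aestronglyMeasurable.2 hm
  rw [← integrable_norm_rpow_iff hm hQ0 hQ]
  have h1 := ProbabilityTheory.IsGaussian.map_eq_gaussianReal (μ := stdGaussian n) (innerSL ℝ v)
  have h2 : Integrable (fun y => Real.exp (a * Q.toReal * y))
      ((stdGaussian n).map (innerSL ℝ v)) := by
    rw [h1]
    exact ProbabilityTheory.integrable_exp_mul_gaussianReal _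
  refine (h2.comp_aemeasurable (by fun_prop)).congr (.of_forall fun x => ?_)
  simp only [Function.comp, innerSL_apply_apply, Real.norm_eq_abs, Real.abs_exp]
  rw [← Real.exp_mul]
  congr 1
  ring

section Translation

variable {n : ℕ} (v : EuclideanSpace ℝ (Fin n))

lemma exp_neg_norm_sub_sq_div_two (x : EuclideanSpace ℝ (Fin n)) :
    Real.exp (-‖x - v‖ ^ 2 / 2) = Real.exp (-‖x‖ ^ 2 / 2) * Real.exp (⟪v, x⟫ - ‖v‖ ^ 2 / 2) := by
  rw [← Real.exp_add, norm_sub_sq_real, real_inner_comm]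
  congr 1
  ring

lemma integral_comp_add_stdGaussian (f : EuclideanSpace ℝ (Fin n) → ℝ) :
    ∫ x, f (x + v) ∂stdGaussian n =
      ∫ x, f x * Real.exp (⟪v, x⟫ - ‖v‖ ^ 2 / 2) ∂stdGaussian n := by
  rw [integral_stdGaussian, integral_stdGaussian, ← integral_sub_right_eq_self _ v]
  refine integral_congr_ae (.of_forall fun x => ?_)
  simp only [sub_add_cancel, smul_eq_mul, exp_neg_norm_sub_sq_div_two]
  ring

lemma integrable_comp_add_stdGaussian {f : EuclideanSpace ℝ (Fin n) → ℝ}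
    (hf : Integrable (fun x => f x * Real.exp (⟪v, x⟫ - ‖v‖ ^ 2 / 2)) (stdGaussian n)) :
    Integrable (fun x => f (x + v)) (stdGaussian n) := by
  rw [integrable_stdGaussian_iff] at hf ⊢
  refine (hf.comp_add_right v).congr (.of_forall fun x => ?_)
  have h := exp_neg_norm_sub_sq_div_two v (x + v)
  rw [add_sub_cancel_right] at h
  simp only [h]
  ring

end Translation

/-- The derivative at the origin of a Gaussian average along translations. -/
lemma hasDerivAt_integral_mul_exp_stdGaussian {n : ℕ} {P Q : ENNReal}
    [ENNReal.HolderTriple P Q 1] (hQ : Q ≠ ⊤) {f : EuclideanSpace ℝ (Fin n) → ℝ}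
    (hf : MemLp f P (stdGaussian n)) (v : EuclideanSpace ℝ (Fin n)) :
    HasDerivAt (fun t : ℝ => ∫ x, f x * Real.exp (⟪t • v, x⟫ - ‖t • v‖ ^ 2 / 2) ∂stdGaussian n)
      (∫ x, f x * ⟪v, x⟫ ∂stdGaussian n) 0 := by
  have hfm := hf.1
  have hP1 : 1 ≤ P := ENNReal.HolderTriple.le P Q 1
  have hin : ∀ x : EuclideanSpace ℝ (Fin n), ∀ t : ℝ,
      ⟪t • v, x⟫ - ‖t • v‖ ^ 2 / 2 = t * ⟪v, x⟫ - t ^ 2 * (‖v‖ ^ 2 / 2) := fun x t => by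
    rw [real_inner_smul_left, norm_smul, mul_pow, Real.norm_eq_abs, sq_abs]
    ring
  simp only [hin]
  let b : EuclideanSpace ℝ (Fin n) → ℝ := fun x =>
    ‖f x‖ * (Real.exp (‖v‖ ^ 2) * (Real.exp (2 * ⟪v, x⟫) + Real.exp (-2 * ⟪v, x⟫)))
  have hb : Integrable b (stdGaussian n) := hf.norm.integrable_mul
    (((memLp_exp_inner_stdGaussian 2 v hQ).add (memLp_exp_inner_stdGaussian (-2) v hQ)).const_mul _)
  have h := (hasDerivAt_integral_of_dominated_loc_of_deriv_le (μ := stdGaussian n) (x₀ := (0 : ℝ))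
    (F := fun t x => f x * Real.exp (t * ⟪v, x⟫ - t ^ 2 * (‖v‖ ^ 2 / 2)))
    (F' := fun t x => f x * (Real.exp (t * ⟪v, x⟫ - t ^ 2 * (‖v‖ ^ 2 / 2)) *
      (⟪v, x⟫ - t * ‖v‖ ^ 2))) (bound := b)
    (Metric.ball_mem_nhds (0 : ℝ) one_pos) (.of_forall fun t => ?_) ?_ ?_
    (.of_forall fun x t ht => ?_) hb (.of_forall fun x t _ => ?_)).2
  · simpa using h
  · exact hfm.mul (Continuous.aestronglyMeasurable (by fun_prop))
  · simpa using hf.integrable hP1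
  · exact hfm.mul (Continuous.aestronglyMeasurable (by fun_prop))
  · have ht1 : |t| ≤ 1 := by simpa using (Metric.mem_ball.1 ht).le
    set s := ⟪v, x⟫ with hs
    have e1 : t * s - t ^ 2 * (‖v‖ ^ 2 / 2) ≤ |s| := by
      have h1 : t * s ≤ |t| * |s| := (le_abs_self _).trans_eq (abs_mul _ _)
      have h2 : |t| * |s| ≤ 1 * |s| := by gcongr
      have h3 : 0 ≤ t ^ 2 * (‖v‖ ^ 2 / 2) := by positivity
      linarith
    have e2 : |s - t * ‖v‖ ^ 2| ≤ Real.exp (|s| + ‖v‖ ^ 2) := by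
      have h1 : |s - t * ‖v‖ ^ 2| ≤ |s| + |t * ‖v‖ ^ 2| := abs_sub _ _
      have h2 : |t * ‖v‖ ^ 2| ≤ 1 * ‖v‖ ^ 2 := by
        rw [abs_mul, abs_of_nonneg (by positivity : 0 ≤ ‖v‖ ^ 2)]
        gcongr
      have h3 := Real.add_one_le_exp (|s| + ‖v‖ ^ 2)
      linarith
    have e3 : Real.exp (2 * |s|) ≤ Real.exp (2 * s) + Real.exp (-2 * s) := by
      rcases abs_cases s with ⟨h1, _⟩ | ⟨h1, _⟩ <;> rw [h1]
      · linarith [Real.exp_pos (-2 * s)]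
      · rw [show 2 * -s = -2 * s by ring]
        linarith [Real.exp_pos (2 * s)]
    rw [norm_mul]
    refine mul_le_mul_of_nonneg_left ?_ (norm_nonneg _)
    rw [norm_mul, Real.norm_eq_abs, Real.abs_exp, Real.norm_eq_abs]
    calc _ ≤ Real.exp |s| * Real.exp (|s| + ‖v‖ ^ 2) := by gcongr
      _ = Real.exp (‖v‖ ^ 2) * Real.exp (2 * |s|) := by
        rw [← Real.exp_add, ← Real.exp_add]
        congr 1
        ring
      _ ≤ _ := by gcongr
  · have h1 : HasDerivAt (fun t : ℝ => t * ⟪v, x⟫ - t ^ 2 * (‖v‖ ^ 2 / 2))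
        (⟪v, x⟫ - t * ‖v‖ ^ 2) t := by
      refine (((hasDerivAt_id t).mul_const _).sub
        ((hasDerivAt_pow 2 t).mul_const _)).congr_deriv ?_
      simp
      ring
    exact h1.exp.const_mul (f x)

/-- Gaussian integration by parts for convex functions. -/
lemma ConvexOn.integral_mul_inner_stdGaussian {n : ℕ} {P Q : ENNReal}
    [ENNReal.HolderTriple P Q 1] (hQ : Q ≠ ⊤) {f : EuclideanSpace ℝ (Fin n) → ℝ}
    (hc : ConvexOn ℝ Set.univ f) (hf : MemLp f P (stdGaussian n))
    (v : EuclideanSpace ℝ (Fin n))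
    (hv : Integrable (fun x => fderiv ℝ f x v) (stdGaussian n)) :
    ∫ x, f x * ⟪v, x⟫ ∂stdGaussian n = ∫ x, fderiv ℝ f x v ∂stdGaussian n := by
  have hP1 : 1 ≤ P := ENNReal.HolderTriple.le P Q 1
  have hfi := hf.integrable hP1
  set m := ∫ x, fderiv ℝ f x v ∂stdGaussian n with hm
  set ψ : ℝ → ℝ := fun t =>
    ∫ x, f x * Real.exp (⟪t • v, x⟫ - ‖t • v‖ ^ 2 / 2) ∂stdGaussian n with hψ
  have hψ0 : ψ 0 = ∫ x, f x ∂stdGaussian n := by simp [hψ]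
  have hd : HasDerivAt (fun t => ψ t - t * m) ((∫ x, f x * ⟪v, x⟫ ∂stdGaussian n) - 1 * m) 0 :=
    (hasDerivAt_integral_mul_exp_stdGaussian hQ hf v).sub ((hasDerivAt_id (0 : ℝ)).mul_const m)
  have hle : ∀ t : ℝ, ψ 0 + t * m ≤ ψ t := fun t => by
    have hti : Integrable (fun x => f (x + t • v)) (stdGaussian n) := by
      refine integrable_comp_add_stdGaussian _ ?_
      have h1 := hf.integrable_mul ((memLp_exp_inner_stdGaussian 1 (t • v) hQ).const_mul
        (Real.exp (-(‖t • v‖ ^ 2 / 2))))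
      refine h1.congr (.of_forall fun x => ?_)
      simp only [Pi.mul_apply, ← Real.exp_add, one_mul]
      rw [neg_add_eq_sub]
    rw [hψ0, hm, ← integral_const_mul, ← integral_add hfi (hv.const_mul t), hψ]
    simp only
    rw [← integral_comp_add_stdGaussian]
    refine integral_mono_ae (hfi.add (hv.const_mul t)) hti ?_
    filter_upwards [hc.ae_differentiableAt_stdGaussian] with x hx
    simpa using hc.add_fderiv_le hx (t • v)
  have hmin : IsLocalMin (fun t => ψ t - t * m) 0 := .of_forall fun t => by
    have := hle t
    simp only
    linarith
  linarith [hmin.hasDerivAt_eq_zero hd]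

lemma memLp_of_integrable_rpow {α F : Type*} [MeasurableSpace α] [NormedAddCommGroup F]
    {ν : Measure α} {f : α → F} (hm : AEStronglyMeasurable f ν) {p : ℝ} (hp : 0 < p)
    (hf : Integrable (fun x => ‖f x‖ ^ p) ν) : MemLp f (ENNReal.ofReal p) ν := by
  rw [← integrable_norm_rpow_iff hm (by simpa using hp) ENNReal.ofReal_ne_top,
    ENNReal.toReal_ofReal hp.le]
  exact hf

lemma ConvexOn.integral_gradient_stdGaussian {n : ℕ} {P Q : ENNReal}
    [ENNReal.HolderTriple P Q 1] (hQ : Q ≠ ⊤) {f : EuclideanSpace ℝ (Fin n) → ℝ}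
    (hc : ConvexOn ℝ Set.univ f) (hf : MemLp f P (stdGaussian n))
    (hg : Integrable (gradient f) (stdGaussian n)) (i : Fin n) :
    (∫ x, gradient f x ∂stdGaussian n) i = ∫ x, f x * x i ∂stdGaussian n := by
  have h1 : ∀ x, gradient f x i = fderiv ℝ f x (EuclideanSpace.single i 1) := fun x => by
    rw [← InnerProductSpace.toDual_symm_apply, real_inner_comm, EuclideanSpace.inner_single_left]
    simp [gradient]
  have h2 : ∀ h : EuclideanSpace ℝ (Fin n), h i = EuclideanSpace.proj (𝕜 := ℝ) i h := fun _ => rfl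
  have h3 := hc.integral_mul_inner_stdGaussian hQ hf (EuclideanSpace.single i 1)
    (((EuclideanSpace.proj (𝕜 := ℝ) i).integrable_comp hg).congr (.of_forall fun x => h1 x))
  rw [h2, ← ContinuousLinearMap.integral_comp_comm _ hg]
  simpa [EuclideanSpace.inner_single_left, h1] using h3.symm

lemma measurable_gradient {V : Type*} [NormedAddCommGroup V] [InnerProductSpace ℝ V]
    [CompleteSpace V] [MeasurableSpace V] [BorelSpace V] (f : V → ℝ) :
    Measurable (gradient f) := by
  borelize (StrongDual ℝ V)
  exact (InnerProductSpace.toDual ℝ V).symm.continuous.measurable.comp (measurable_fderiv ℝ f)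

/-- Covariance inequality for convex functions under the Gaussian measure:
`E[fg] ≥ E[f]E[g] + ⟨E[∇f], E[∇g]⟩`. -/
theorem gaussian_convex_covariance (n : ℕ) (hn : 1 ≤ n)
    (p q : ℝ) (hp : 1 < p) (hq : 1 < q) (hpq : 1 / p + 1 / q = 1)
    (f g : EuclideanSpace ℝ (Fin n) → ℝ)
    (hfconv : ConvexOn ℝ Set.univ f) (hgconv : ConvexOn ℝ Set.univ g)
    (hfp : Integrable (fun x => |f x| ^ p) (stdGaussian n))
    (hfgradp : Integrable (fun x => ‖gradient f x‖ ^ p) (stdGaussian n))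
    (hgq : Integrable (fun x => |g x| ^ q) (stdGaussian n))
    (hggradq : Integrable (fun x => ‖gradient g x‖ ^ q) (stdGaussian n)) :
    (∫ x, f x ∂stdGaussian n) * (∫ x, g x ∂stdGaussian n)
        + ⟪∫ x, gradient f x ∂stdGaussian n, ∫ x, gradient g x ∂stdGaussian n⟫
      ≤ ∫ x, f x * g x ∂stdGaussian n := by
  have hP : ENNReal.HolderTriple (ENNReal.ofReal p) (ENNReal.ofReal q) 1 :=
    Real.HolderConjugate.ennrealOfReal (Real.holderConjugate_iff.2 ⟨hp, by simpa using hpq⟩)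
  have hQ : ENNReal.HolderTriple (ENNReal.ofReal q) (ENNReal.ofReal p) 1 := hP.symm
  have hf := memLp_of_integrable_rpow hfconv.locallyLipschitz.continuous.aestronglyMeasurable
    (by linarith) hfp
  have hg := memLp_of_integrable_rpow hgconv.locallyLipschitz.continuous.aestronglyMeasurable
    (by linarith) hgq
  have hf' := (memLp_of_integrable_rpow (measurable_gradient f).aestronglyMeasurable
    (by linarith) hfgradp).integrable (by simpa using hp.le)
  have hg' := (memLp_of_integrable_rpow (measurable_gradient g).aestronglyMeasurable
    (by linarith) hggradq).integrable (by simpa using hq.le)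
  refine le_of_eq_of_le ?_ (gaussianCovarianceIneq_of_memLp (P := ENNReal.ofReal p)
    (Q := ENNReal.ofReal q) ENNReal.ofReal_ne_top ENNReal.ofReal_ne_top hfconv hgconv hf hg)
  simp only [PiLp.inner_apply, hfconv.integral_gradient_stdGaussian
    (Q := ENNReal.ofReal q) ENNReal.ofReal_ne_top hf hf',
    hgconv.integral_gradient_stdGaussian (Q := ENNReal.ofReal p) ENNReal.ofReal_ne_top hg hg']
  simp [mul_comm]
end
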